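/- Let k, k', d₀ be natural numbers with k' ≤ k, k ≥ 1 and d₀ ≥ 1. Let 𝒬 and 𝒫 be finite sets of real polynomials in k variables such that every Q ∈ 𝒬 has total degree at most d₀, and let Z = {x ∈ ℝ^k : Q(x) = 0 for all Q ∈ 𝒬}. Assume the Hausdorff dimension of Z is at most k'. Then for every sign condition σ : 𝒫 → {−1,0,1} the realization R(σ,Z) has only finitely many connected components, and the sum over all sign conditions σ ∈ {−1,0,1}^𝒫 of the number of connected components of R(σ,Z) is at most ∑_{I ⊆ 𝒫, #I ≤ k'} 4^{#I} · ( binom(k+1, k−k'+#I+1) · (2d₀)^{k−k'} · (∏_{P∈I} deg P) · (max(2d₀, max_{P∈I} deg P))^{k'−#I} + 2(k−#I+1) ), where deg denotes total degree, the empty product is 1, and max_{P∈∅} deg P = 0 (so for I = ∅ the middle factor is (2d₀)^{k'}). -/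

import Mathlib

open MvPolynomial ENNReal

namespace SignCondition

section Growth

variable {R : Type*} [CommRing R] [Algebra ℝ R] {K M : ℕ}

/-- The linear combination of the vectors `v i` with coefficients on the moment curve. -/
def momentForm (v : Fin (K + 1) → R) (t : ℝ) : R := ∑ i : Fin (K + 1), t ^ (i : ℕ) • v i

/-- The products of `N` elements of the span of `v` and `N₂` elements of the span of `w`. -/
def bigraded (v : Fin (K + 1) → R) (w : Fin (M + 1) → R) (N N₂ : ℕ) : Submodule ℝ R :=
  Submodule.span ℝ (Set.range v) ^ N * Submodule.span ℝ (Set.range w) ^ N₂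

/-- The multiples of a product of moment forms inside a bigraded piece. -/
def formMultiples (v : Fin (K + 1) → R) (w : Fin (M + 1) → R) (e : ℝ × ℕ × ℕ) (N N₂ : ℕ) :
    Submodule ℝ R :=
  Submodule.span ℝ {momentForm v e.1 ^ e.2.1 * momentForm w e.1 ^ e.2.2} *
    bigraded v w (N - e.2.1) (N₂ - e.2.2)

/-- The bigraded piece of the ideal generated by a multiset of products of moment forms. -/
def idealPiece (v : Fin (K + 1) → R) (w : Fin (M + 1) → R) (L : Multiset (ℝ × ℕ × ℕ))
    (N N₂ : ℕ) : Submodule ℝ R :=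
  (L.map fun e => formMultiples v w e N N₂).sum

/-- The quotient by the ideal of `L` has dimension at most `D` in all large bidegrees. -/
def CodimLE (v : Fin (K + 1) → R) (w : Fin (M + 1) → R) (L : Multiset (ℝ × ℕ × ℕ)) (D : ℕ) :
    Prop :=
  ∃ N₀, ∀ N ≥ N₀, ∀ N₂ ≥ N₀, ∃ T : Finset R, T.card ≤ D ∧
    bigraded v w N N₂ ≤ Submodule.span ℝ (T : Set R) + idealPiece v w L N N₂

variable (v : Fin (K + 1) → R) (w : Fin (M + 1) → R)

lemma momentForm_mem (t : ℝ) : momentForm v t ∈ Submodule.span ℝ (Set.range v) :=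
  Submodule.sum_mem _ fun i _ => Submodule.smul_mem _ _ (Submodule.subset_span ⟨i, rfl⟩)

lemma span_momentForm_le (t : ℝ) :
    Submodule.span ℝ {momentForm v t} ≤ Submodule.span ℝ (Set.range v) := by
  rw [Submodule.span_singleton_le_iff_mem]
  exact momentForm_mem v t

lemma span_range_le_sum_momentForm (P : Finset ℝ) (hP : K + 1 ≤ P.card) :
    Submodule.span ℝ (Set.range v) ≤ ∑ t ∈ P, Submodule.span ℝ {momentForm v t} := by
  obtain ⟨P', hP', hcard⟩ := Finset.exists_subset_card_eq hP
  let e : Fin (K + 1) ≃ P' := (P'.equivFinOfCardEq hcard).symm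
  let t : Fin (K + 1) → ℝ := fun i => (e i : ℝ)
  have ht : Function.Injective t := Subtype.val_injective.comp e.injective
  have hdet : IsUnit (Matrix.vandermonde t).det :=
    isUnit_iff_ne_zero.2 (Matrix.det_vandermonde_ne_zero_iff.2 ht)
  rw [Submodule.span_le]
  rintro _ ⟨j, rfl⟩
  have key : v j = ∑ i, (Matrix.vandermonde t)⁻¹ j i • momentForm v (t i) := by
    have h1 : (Matrix.vandermonde t)⁻¹ * Matrix.vandermonde t = 1 :=
      Matrix.nonsing_inv_mul _ hdet
    simp only [momentForm, Finset.smul_sum, smul_smul]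
    rw [Finset.sum_comm]
    have h2 : ∀ l : Fin (K + 1), ∑ i, ((Matrix.vandermonde t)⁻¹ j i * t i ^ (l : ℕ)) • v l
        = (if j = l then (1 : ℝ) else 0) • v l := by
      intro l
      rw [← Finset.sum_smul]
      congr 1
      have := congrFun (congrFun h1 j) l
      rw [Matrix.mul_apply, Matrix.one_apply] at this
      exact this
    simp [h2]
  rw [key]
  refine Submodule.sum_mem _ fun i _ => Submodule.smul_mem _ _ ?_
  have : Submodule.span ℝ {momentForm v (t i)} ≤ ∑ t ∈ P, Submodule.span ℝ {momentForm v t} :=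
    Finset.single_le_sum (f := fun t => Submodule.span ℝ {momentForm v t})
      (fun _ _ => bot_le) (hP' (e i).2)
  exact this (Submodule.mem_span_singleton_self _)

lemma pow_span_le (P : Finset ℝ) (hP : K ≤ P.card) {s : ℝ} (hs : s ∉ P) (N : ℕ) :
    Submodule.span ℝ (Set.range v) ^ N ≤ Submodule.span ℝ {momentForm v s ^ N} +
      (∑ t ∈ P, Submodule.span ℝ {momentForm v t}) * Submodule.span ℝ (Set.range v) ^ (N - 1) := by
  set A := Submodule.span ℝ (Set.range v)
  set X := ∑ t ∈ P, Submodule.span ℝ {momentForm v t}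
  set S := Submodule.span ℝ {momentForm v s}
  have hA : A ≤ S + X := by
    have := span_range_le_sum_momentForm v (insert s P)
      (by rw [Finset.card_insert_of_notMem hs]; omega)
    rwa [Finset.sum_insert hs] at this
  have hS : S ≤ A := span_momentForm_le v s
  induction N with
  | zero => simp [Submodule.one_eq_span]
  | succ N ih =>
    rw [pow_succ', pow_succ', ← Set.singleton_mul_singleton, ← Submodule.span_mul_span]
    rcases N with _ | N
    · simp only [pow_zero, mul_one, zero_add, Nat.sub_self]
      rw [← Submodule.one_eq_span, mul_one]
      exact hA
    · calc A * A ^ (N + 1) ≤ (S + X) * A ^ (N + 1) := by gcongr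
        _ = S * A ^ (N + 1) + X * A ^ (N + 1) := by ring
        _ ≤ S * (Submodule.span ℝ {momentForm v s ^ (N + 1)} + X * A ^ N)
            + X * A ^ (N + 1) := by gcongr; exact ih
        _ = S * Submodule.span ℝ {momentForm v s ^ (N + 1)} + X * (S * A ^ N)
            + X * A ^ (N + 1) := by ring
        _ ≤ S * Submodule.span ℝ {momentForm v s ^ (N + 1)} + X * (A * A ^ N)
            + X * A ^ (N + 1) := by gcongr
        _ = S * Submodule.span ℝ {momentForm v s ^ (N + 1)} +
            (X * A ^ (N + 1) + X * A ^ (N + 1)) := by ring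
        _ = _ := by simp [S, Submodule.add_eq_sup]

lemma idealPiece_cons (e : ℝ × ℕ × ℕ) (L : Multiset (ℝ × ℕ × ℕ)) (N N₂ : ℕ) :
    idealPiece v w (e ::ₘ L) N N₂ = formMultiples v w e N N₂ + idealPiece v w L N N₂ := by
  simp [idealPiece]

lemma span_mul_formMultiples_le (t : ℝ) (e : ℝ × ℕ × ℕ) (N N₂ : ℕ) (h : e.2.1 ≤ N) :
    Submodule.span ℝ {momentForm v t} * formMultiples v w e N N₂ ≤
      formMultiples v w e (N + 1) N₂ := by
  unfold formMultiples bigraded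
  rw [Nat.succ_sub h, Nat.succ_eq_add_one, pow_succ']
  set A := Submodule.span ℝ (Set.range v)
  set S := Submodule.span ℝ {momentForm v t}
  have hS : S ≤ A := span_momentForm_le v t
  set G := Submodule.span ℝ {momentForm v e.1 ^ e.2.1 * momentForm w e.1 ^ e.2.2}
  set B := Submodule.span ℝ (Set.range w)
  calc S * (G * (A ^ (N - e.2.1) * B ^ (N₂ - e.2.2)))
      = G * (S * A ^ (N - e.2.1) * B ^ (N₂ - e.2.2)) := by ring
    _ ≤ _ := by gcongr

lemma span_mul_formMultiples_le' (t : ℝ) (e : ℝ × ℕ × ℕ) (N N₂ : ℕ) (h : e.2.2 ≤ N₂) :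
    Submodule.span ℝ {momentForm w t} * formMultiples v w e N N₂ ≤
      formMultiples v w e N (N₂ + 1) := by
  unfold formMultiples bigraded
  rw [Nat.succ_sub h, Nat.succ_eq_add_one, pow_succ']
  set B := Submodule.span ℝ (Set.range w)
  set S := Submodule.span ℝ {momentForm w t}
  have hS : S ≤ B := span_momentForm_le w t
  set G := Submodule.span ℝ {momentForm v e.1 ^ e.2.1 * momentForm w e.1 ^ e.2.2}
  set A := Submodule.span ℝ (Set.range v)
  calc S * (G * (A ^ (N - e.2.1) * B ^ (N₂ - e.2.2)))
      = G * (A ^ (N - e.2.1) * (S * B ^ (N₂ - e.2.2))) := by ring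
    _ ≤ _ := by gcongr

lemma span_mul_idealPiece_le (t : ℝ) (L : Multiset (ℝ × ℕ × ℕ)) (N N₂ : ℕ)
    (h : ∀ e ∈ L, e.2.1 ≤ N) :
    Submodule.span ℝ {momentForm v t} * idealPiece v w L N N₂ ≤ idealPiece v w L (N + 1) N₂ := by
  induction L using Multiset.induction with
  | empty => simp [idealPiece]
  | cons e L ih =>
    rw [idealPiece_cons, idealPiece_cons, mul_add]
    exact add_le_add (span_mul_formMultiples_le v w t e N N₂ (h e (Multiset.mem_cons_self e L)))
      (ih fun e' he' => h e' (Multiset.mem_cons_of_mem he'))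

lemma span_mul_idealPiece_le' (t : ℝ) (L : Multiset (ℝ × ℕ × ℕ)) (N N₂ : ℕ)
    (h : ∀ e ∈ L, e.2.2 ≤ N₂) :
    Submodule.span ℝ {momentForm w t} * idealPiece v w L N N₂ ≤ idealPiece v w L N (N₂ + 1) := by
  induction L using Multiset.induction with
  | empty => simp [idealPiece]
  | cons e L ih =>
    rw [idealPiece_cons, idealPiece_cons, mul_add]
    exact add_le_add (span_mul_formMultiples_le' v w t e N N₂ (h e (Multiset.mem_cons_self e L)))
      (ih fun e' he' => h e' (Multiset.mem_cons_of_mem he'))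

lemma exists_degree_bound (L : Multiset (ℝ × ℕ × ℕ)) :
    ∃ n, ∀ e ∈ L, e.2.1 ≤ n ∧ e.2.2 ≤ n := by
  induction L using Multiset.induction with
  | empty => simp
  | cons e L ih =>
    obtain ⟨n, hn⟩ := ih
    refine ⟨max n (max e.2.1 e.2.2), fun e' he' => ?_⟩
    rcases Multiset.mem_cons.1 he' with rfl | h
    · simp
    · exact ⟨(hn e' h).1.trans (le_max_left _ _), (hn e' h).2.trans (le_max_left _ _)⟩

variable {v w}

lemma CodimLE.mono {L : Multiset (ℝ × ℕ × ℕ)} {D D' : ℕ} (h : CodimLE v w L D) (hD : D ≤ D') :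
    CodimLE v w L D' := by
  obtain ⟨n, hn⟩ := h
  refine ⟨n, fun N hN N₂ hN' => ?_⟩
  obtain ⟨T, hT, h⟩ := hn N hN N₂ hN'
  exact ⟨T, hT.trans hD, h⟩

lemma span_le_add_of_mul {T₁ T₂ : Finset R} {s : R} {V V' W W' F : Submodule ℝ R}
    (h₁ : V ≤ Submodule.span ℝ (T₁ : Set R) + (Submodule.span ℝ {s} * V' + W))
    (h₂ : V' ≤ Submodule.span ℝ (T₂ : Set R) + (F + W'))
    (h₃ : Submodule.span ℝ {s} * W' ≤ W) :
    ∃ T : Finset R, T.card ≤ T₁.card + T₂.card ∧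
      V ≤ Submodule.span ℝ (T : Set R) + (Submodule.span ℝ {s} * F + W) := by
  classical
  refine ⟨T₁ ∪ T₂.image (s * ·),
    (Finset.card_union_le _ _).trans (Nat.add_le_add_left Finset.card_image_le _), ?_⟩
  have hT : Submodule.span ℝ ((T₁ ∪ T₂.image (s * ·) : Finset R) : Set R) =
      Submodule.span ℝ (T₁ : Set R) + Submodule.span ℝ {s} * Submodule.span ℝ (T₂ : Set R) := by
    rw [Finset.coe_union, Submodule.span_union, Submodule.span_mul_span, Set.singleton_mul,
      Finset.coe_image]
    rfl
  rw [hT]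
  calc V ≤ Submodule.span ℝ (T₁ : Set R) + (Submodule.span ℝ {s} * V' + W) := h₁
    _ ≤ Submodule.span ℝ (T₁ : Set R) + (Submodule.span ℝ {s} *
        (Submodule.span ℝ (T₂ : Set R) + (F + W')) + W) := by gcongr
    _ = Submodule.span ℝ (T₁ : Set R) + Submodule.span ℝ {s} * Submodule.span ℝ (T₂ : Set R)
        + (Submodule.span ℝ {s} * F + (Submodule.span ℝ {s} * W' + W)) := by ring
    _ ≤ Submodule.span ℝ (T₁ : Set R) + Submodule.span ℝ {s} * Submodule.span ℝ (T₂ : Set R)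
        + (Submodule.span ℝ {s} * F + (W + W)) := by gcongr
    _ = _ := by simp [Submodule.add_eq_sup]

lemma CodimLE.succ_left {L : Multiset (ℝ × ℕ × ℕ)} {t : ℝ} {a b D₁ D₂ : ℕ}
    (h₁ : CodimLE v w ((t, 1, 0) ::ₘ L) D₁) (h₂ : CodimLE v w ((t, a, b) ::ₘ L) D₂) :
    CodimLE v w ((t, a + 1, b) ::ₘ L) (D₁ + D₂) := by
  obtain ⟨n₁, h₁⟩ := h₁
  obtain ⟨n₂, h₂⟩ := h₂
  obtain ⟨n₃, h₃⟩ := exists_degree_bound L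
  refine ⟨n₁ + n₂ + n₃ + 1, fun N hN N₂ hN' => ?_⟩
  obtain ⟨N, rfl⟩ : ∃ n, N = n + 1 := ⟨N - 1, by omega⟩
  obtain ⟨T₁, hT₁, h₁⟩ := h₁ (N + 1) (by omega) N₂ (by omega)
  obtain ⟨T₂, hT₂, h₂⟩ := h₂ N (by omega) N₂ (by omega)
  rw [idealPiece_cons] at h₁ h₂ ⊢
  simp only [formMultiples, pow_one, pow_zero, mul_one, Nat.add_sub_cancel, Nat.sub_zero] at h₁
  obtain ⟨T, hT, h⟩ := span_le_add_of_mul h₁ h₂ (span_mul_idealPiece_le v w t L N N₂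
    fun e he => (h₃ e he).1.trans (by omega))
  refine ⟨T, hT.trans (by omega), h.trans_eq ?_⟩
  simp only [formMultiples]
  rw [← mul_assoc, Submodule.span_mul_span, Set.singleton_mul_singleton, pow_succ' _ a, mul_assoc,
    Nat.add_sub_add_right]

lemma CodimLE.succ_right {L : Multiset (ℝ × ℕ × ℕ)} {t : ℝ} {a b D₁ D₂ : ℕ}
    (h₁ : CodimLE v w ((t, 0, 1) ::ₘ L) D₁) (h₂ : CodimLE v w ((t, a, b) ::ₘ L) D₂) :
    CodimLE v w ((t, a, b + 1) ::ₘ L) (D₁ + D₂) := by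
  obtain ⟨n₁, h₁⟩ := h₁
  obtain ⟨n₂, h₂⟩ := h₂
  obtain ⟨n₃, h₃⟩ := exists_degree_bound L
  refine ⟨n₁ + n₂ + n₃ + 1, fun N hN N₂ hN' => ?_⟩
  obtain ⟨N₂, rfl⟩ : ∃ n, N₂ = n + 1 := ⟨N₂ - 1, by omega⟩
  obtain ⟨T₁, hT₁, h₁⟩ := h₁ N (by omega) (N₂ + 1) (by omega)
  obtain ⟨T₂, hT₂, h₂⟩ := h₂ N (by omega) N₂ (by omega)
  rw [idealPiece_cons] at h₁ h₂ ⊢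
  simp only [formMultiples, pow_one, pow_zero, one_mul, Nat.add_sub_cancel, Nat.sub_zero] at h₁
  obtain ⟨T, hT, h⟩ := span_le_add_of_mul h₁ h₂ (span_mul_idealPiece_le' v w t L N N₂
    fun e he => (h₃ e he).2.trans (by omega))
  refine ⟨T, hT.trans (by omega), h.trans_eq ?_⟩
  simp only [formMultiples]
  rw [← mul_assoc, Submodule.span_mul_span, Set.singleton_mul_singleton, pow_succ' _ b,
    mul_left_comm, Nat.add_sub_add_right]

lemma codimLE_unit (L : Multiset (ℝ × ℕ × ℕ)) (t : ℝ) : CodimLE v w ((t, 0, 0) ::ₘ L) 0 := by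
  refine ⟨0, fun N _ N₂ _ => ⟨∅, le_rfl, ?_⟩⟩
  rw [idealPiece_cons]
  simp [formMultiples, ← Submodule.one_eq_span, Submodule.add_eq_sup]

lemma CodimLE.cons {L : Multiset (ℝ × ℕ × ℕ)} {t : ℝ} {D₁ D₂ : ℕ}
    (h₁ : CodimLE v w ((t, 1, 0) ::ₘ L) D₁) (h₂ : CodimLE v w ((t, 0, 1) ::ₘ L) D₂) (a b : ℕ) :
    CodimLE v w ((t, a, b) ::ₘ L) (a * D₁ + b * D₂) := by
  induction a with
  | zero =>
    induction b with
    | zero => simpa using codimLE_unit L t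
    | succ b ih => exact (h₂.succ_right ih).mono (by ring_nf; rfl)
  | succ a ih => exact (h₁.succ_left ih).mono (by ring_nf; rfl)

/-- The multiset of single moment forms with parameters in `P` and `Q`. -/
def singles (P Q : Finset ℝ) : Multiset (ℝ × ℕ × ℕ) :=
  P.val.map (fun t => (t, 1, 0)) + Q.val.map (fun t => (t, 0, 1))

lemma idealPiece_singles (v : Fin (K + 1) → R) (w : Fin (M + 1) → R) (P Q : Finset ℝ)
    (N N₂ : ℕ) : idealPiece v w (singles P Q) N N₂ =
      (∑ t ∈ P, Submodule.span ℝ {momentForm v t}) * bigraded v w (N - 1) N₂ +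
      (∑ t ∈ Q, Submodule.span ℝ {momentForm w t}) * bigraded v w N (N₂ - 1) := by
  simp only [idealPiece, singles, Multiset.map_add, Multiset.map_map, Multiset.sum_add,
    formMultiples, Function.comp_def, pow_one, pow_zero, mul_one, one_mul, Nat.sub_zero,
    Finset.sum_mul]
  rfl

lemma codimLE_singles_zero_left (P Q : Finset ℝ) (hP : K + 1 ≤ P.card) :
    CodimLE v w (singles P Q) 0 := by
  refine ⟨1, fun N hN N₂ _ => ⟨∅, le_rfl, ?_⟩⟩
  obtain ⟨N, rfl⟩ : ∃ n, N = n + 1 := ⟨N - 1, by omega⟩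
  rw [idealPiece_singles]
  refine le_trans ?_ le_add_self
  refine le_trans ?_ (le_add_of_nonneg_right bot_le)
  rw [Nat.add_sub_cancel, bigraded, pow_succ', mul_assoc]
  exact mul_le_mul' (span_range_le_sum_momentForm v P hP) le_rfl

lemma codimLE_singles_zero_right (P Q : Finset ℝ) (hQ : M + 1 ≤ Q.card) :
    CodimLE v w (singles P Q) 0 := by
  refine ⟨1, fun N _ N₂ hN' => ⟨∅, le_rfl, ?_⟩⟩
  obtain ⟨N₂, rfl⟩ : ∃ n, N₂ = n + 1 := ⟨N₂ - 1, by omega⟩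
  rw [idealPiece_singles]
  refine le_trans ?_ le_add_self
  refine le_trans ?_ le_add_self
  rw [Nat.add_sub_cancel, bigraded, pow_succ', mul_left_comm]
  exact mul_le_mul' (span_range_le_sum_momentForm w Q hQ) le_rfl

lemma codimLE_singles_one (P Q : Finset ℝ) (hP : K ≤ P.card) (hQ : M ≤ Q.card) :
    CodimLE v w (singles P Q) 1 := by
  obtain ⟨s, hs⟩ := Infinite.exists_notMem_finset P
  obtain ⟨u, hu⟩ := Infinite.exists_notMem_finset Q
  refine ⟨1, fun N hN N₂ hN' => ⟨{momentForm v s ^ N * momentForm w u ^ N₂}, by simp, ?_⟩⟩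
  rw [idealPiece_singles]
  have hA := pow_span_le v P hP hs N
  have hB := pow_span_le w Q hQ hu N₂
  have hs' : Submodule.span ℝ {momentForm v s ^ N} ≤ Submodule.span ℝ (Set.range v) ^ N := by
    rw [Submodule.span_singleton_le_iff_mem]
    exact Submodule.pow_mem_pow _ (momentForm_mem v s) N
  unfold bigraded
  rw [Finset.coe_singleton, ← Set.singleton_mul_singleton, ← Submodule.span_mul_span]
  generalize Submodule.span ℝ (Set.range v) = A at *
  generalize Submodule.span ℝ (Set.range w) = B at *
  generalize Submodule.span ℝ {momentForm v s ^ N} = S at *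
  generalize Submodule.span ℝ {momentForm w u ^ N₂} = U at *
  generalize (∑ t ∈ P, Submodule.span ℝ {momentForm v t}) = X at *
  generalize (∑ t ∈ Q, Submodule.span ℝ {momentForm w t}) = Y at *
  calc A ^ N * B ^ N₂ ≤ (S + X * A ^ (N - 1)) * B ^ N₂ := by gcongr
    _ = S * B ^ N₂ + X * (A ^ (N - 1) * B ^ N₂) := by ring
    _ ≤ S * (U + Y * B ^ (N₂ - 1)) + X * (A ^ (N - 1) * B ^ N₂) := by gcongr
    _ = S * U + (X * (A ^ (N - 1) * B ^ N₂) + Y * (S * B ^ (N₂ - 1))) := by ring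
    _ ≤ _ := by gcongr

/-- The mixed Bézout number of a list of bidegrees in the variable groups of sizes `K` and `M`,
when `p` and `q` linear equations in the two groups have already been imposed. -/
def mixedBezout (K M : ℕ) : List (ℕ × ℕ) → ℕ → ℕ → ℕ
  | [], p, q => if p = K ∧ q = M then 1 else 0
  | (a, b) :: l, p, q => a * mixedBezout K M l (p + 1) q + b * mixedBezout K M l p (q + 1)

lemma singles_insert_left {P Q : Finset ℝ} {t : ℝ} (ht : t ∉ P) :
    singles (insert t P) Q = (t, 1, 0) ::ₘ singles P Q := by
  simp [singles, Finset.insert_val_of_notMem ht]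

lemma singles_insert_right {P Q : Finset ℝ} {t : ℝ} (ht : t ∉ Q) :
    singles P (insert t Q) = (t, 0, 1) ::ₘ singles P Q := by
  simp [singles, Finset.insert_val_of_notMem ht]

theorem codimLE_mixedBezout (l : List (ℝ × ℕ × ℕ)) (P Q : Finset ℝ)
    (hl : (l.map Prod.fst).Nodup) (hPQ : ∀ e ∈ l, e.1 ∉ P ∧ e.1 ∉ Q)
    (hcard : P.card + Q.card + l.length = K + M) :
    CodimLE v w (singles P Q + (l : Multiset (ℝ × ℕ × ℕ)))
      (mixedBezout K M (l.map Prod.snd) P.card Q.card) := by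
  induction l generalizing P Q with
  | nil =>
    simp only [Multiset.coe_nil, add_zero, List.map_nil, mixedBezout, List.length_nil] at hcard ⊢
    split_ifs with h
    · exact codimLE_singles_one P Q h.1.ge h.2.ge
    · rcases Nat.lt_or_ge K P.card with h' | h'
      · exact codimLE_singles_zero_left P Q h'
      · exact codimLE_singles_zero_right P Q (by omega)
  | cons e l ih =>
    obtain ⟨t, a, b⟩ := e
    simp only [List.map_cons, List.nodup_cons, List.length_cons] at hl hcard
    obtain ⟨htP, htQ⟩ := hPQ (t, a, b) (by simp)
    have hne : ∀ e ∈ l, e.1 ≠ t := fun e he h => hl.1 (List.mem_map.2 ⟨e, he, h⟩)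
    have hx := ih (insert t P) Q hl.2
      (fun e he => ⟨by simpa [hne e he] using (hPQ e (by simp [he])).1,
        (hPQ e (by simp [he])).2⟩)
      (by rw [Finset.card_insert_of_notMem htP]; omega)
    have hy := ih P (insert t Q) hl.2
      (fun e he => ⟨(hPQ e (by simp [he])).1,
        by simpa [hne e he] using (hPQ e (by simp [he])).2⟩)
      (by rw [Finset.card_insert_of_notMem htQ]; omega)
    rw [singles_insert_left htP, Finset.card_insert_of_notMem htP, Multiset.cons_add] at hx
    rw [singles_insert_right htQ, Finset.card_insert_of_notMem htQ, Multiset.cons_add] at hy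
    rw [← Multiset.cons_coe, Multiset.add_cons]
    exact hx.cons hy a b

end Growth

section Rank

variable {H R : Type*} [AddCommGroup H] [Module ℝ H] [AddCommGroup R] [Module ℝ R]

lemma finite_finrank_range_add_smul_lt [FiniteDimensional ℝ H] (f g : H →ₗ[ℝ] R) :
    {τ : ℝ | Module.finrank ℝ (LinearMap.range (f + τ • g)) <
      Module.finrank ℝ (LinearMap.range g)}.Finite := by
  obtain ⟨C, hC⟩ := Submodule.exists_isCompl (LinearMap.ker g)
  have hinj : LinearMap.ker (g ∘ₗ C.subtype) = ⊥ := by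
    rw [LinearMap.ker_eq_bot']
    intro c hc
    have : (c : H) ∈ LinearMap.ker g ⊓ C := ⟨hc, c.2⟩
    rw [hC.inf_eq_bot] at this
    exact Subtype.ext this
  obtain ⟨L, hL⟩ := (g ∘ₗ C.subtype).exists_leftInverse_of_injective hinj
  have hdim : Module.finrank ℝ C = Module.finrank ℝ (LinearMap.range g) := by
    have h1 := Submodule.finrank_add_eq_of_isCompl hC
    have h2 := g.finrank_range_add_finrank_ker
    omega
  have hfin := Module.End.finite_hasEigenvalue (-(L ∘ₗ f ∘ₗ C.subtype))
  refine hfin.subset fun τ hτ => ?_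
  by_contra hev
  refine absurd (Set.mem_ofPred.1 hτ) (not_lt.2 ?_)
  rw [← hdim]
  have hker : LinearMap.ker ((f + τ • g) ∘ₗ C.subtype) = ⊥ := by
    rw [LinearMap.ker_eq_bot']
    intro c hc
    by_contra hne
    refine hev (Module.End.hasEigenvalue_of_hasEigenvector (x := c) ⟨?_, hne⟩)
    rw [Module.End.mem_eigenspace_iff]
    have h1 := congrArg L hc
    have h2 := LinearMap.congr_fun hL c
    simp only [LinearMap.comp_apply, LinearMap.add_apply, LinearMap.smul_apply, map_add, map_smul,
      map_zero, LinearMap.id_apply, LinearMap.neg_apply] at h1 h2 ⊢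
    rw [h2] at h1
    exact neg_eq_of_add_eq_zero_right h1
  calc Module.finrank ℝ C = Module.finrank ℝ (LinearMap.range ((f + τ • g) ∘ₗ C.subtype)) :=
        (LinearMap.finrank_range_of_inj (LinearMap.ker_eq_bot.1 hker)).symm
    _ ≤ _ := Submodule.finrank_mono (LinearMap.range_comp_le_range _ _)

end Rank

section Bezout

variable {E : Type*} {K M n : ℕ}

lemma one_le_pow_of_le {A : Type*} [CommRing A] [Algebra ℝ A] {U : Submodule ℝ A} (h : 1 ≤ U)
    {i j : ℕ} (hij : i ≤ j) : U ^ i ≤ U ^ j :=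
  pow_le_pow_right' h hij

lemma bigraded_mul_mem {R : Type*} [CommRing R] [Algebra ℝ R] {v : Fin (K + 1) → R}
    {w : Fin (M + 1) → R} {f g : R} {a b N N₂ : ℕ} (ha : a ≤ N) (hb : b ≤ N₂)
    (hf : f ∈ bigraded v w a b) (hg : g ∈ bigraded v w (N - a) (N₂ - b)) :
    f * g ∈ bigraded v w N N₂ := by
  have := Submodule.mul_mem_mul hf hg
  unfold bigraded at this ⊢
  rwa [mul_mul_mul_comm, ← pow_add, ← pow_add, Nat.add_sub_cancel' ha, Nat.add_sub_cancel' hb]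
    at this

instance finiteDimensional_bigraded {R : Type*} [CommRing R] [Algebra ℝ R] (v : Fin (K + 1) → R)
    (w : Fin (M + 1) → R) (N N₂ : ℕ) : FiniteDimensional ℝ (bigraded v w N N₂) := by
  have h1 : (Submodule.span ℝ (Set.range v)).FG := Submodule.fg_span (Set.finite_range v)
  have h2 : (Submodule.span ℝ (Set.range w)).FG := Submodule.fg_span (Set.finite_range w)
  exact Module.Finite.iff_fg.2 ((h1.pow N).mul (h2.pow N₂))

/-- Interpolation at finitely many points by elements of a bigraded piece. -/
lemma exists_mem_bigraded_eq_single (v : Fin (K + 1) → E → ℝ) (w : Fin (M + 1) → E → ℝ)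
    (hv : v 0 = 1) (hw : w 0 = 1)
    (hsep : ∀ x y, (∀ i, v i x = v i y) → (∀ i, w i x = w i y) → x = y) (S : Finset E)
    {N N₂ : ℕ} (hN : S.card ≤ N) (hN' : S.card ≤ N₂) (s : E) :
    ∃ f ∈ bigraded v w N N₂, f s = 1 ∧ ∀ t ∈ S, t ≠ s → f t = 0 := by
  classical
  set A := Submodule.span ℝ (Set.range v)
  set B := Submodule.span ℝ (Set.range w)
  have h1A : (1 : Submodule ℝ (E → ℝ)) ≤ A := by
    rw [Submodule.one_eq_span, Submodule.span_singleton_le_iff_mem, ← hv]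
    exact Submodule.subset_span ⟨0, rfl⟩
  have h1B : (1 : Submodule ℝ (E → ℝ)) ≤ B := by
    rw [Submodule.one_eq_span, Submodule.span_singleton_le_iff_mem, ← hw]
    exact Submodule.subset_span ⟨0, rfl⟩
  have hAAB : A ≤ A * B := le_mul_of_one_le_right' h1B
  have hBAB : B ≤ A * B := le_mul_of_one_le_left' h1A
  have h1AB : 1 ≤ A * B := h1A.trans hAAB
  have key : ∀ T : Finset E, s ∉ T →
      ∃ f ∈ (A * B) ^ T.card, f s = 1 ∧ ∀ t ∈ T, f t = 0 := by
    intro T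
    induction T using Finset.induction with
    | empty => exact fun _ => ⟨1, by simp [Submodule.one_le.1 le_rfl], rfl, by simp⟩
    | insert t T htT ih =>
      intro hsT
      rw [Finset.mem_insert, not_or] at hsT
      obtain ⟨f, hf, hfs, hfT⟩ := ih hsT.2
      have hlin : ∃ g ∈ A * B, g s = 1 ∧ g t = 0 := by
        have : ∃ u ∈ A * B, u s ≠ u t := by
          by_contra! hcon
          exact hsT.1 (hsep s t (fun i => hcon _ (hAAB (Submodule.subset_span ⟨i, rfl⟩)))
            (fun i => hcon _ (hBAB (Submodule.subset_span ⟨i, rfl⟩))))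
        obtain ⟨u, hu, hne⟩ := this
        refine ⟨(u s - u t)⁻¹ • (u - u t • 1), Submodule.smul_mem _ _ (Submodule.sub_mem _ hu
          (Submodule.smul_mem _ _ (Submodule.one_le.1 h1AB))), ?_, ?_⟩
        · have : u s - u t ≠ 0 := sub_ne_zero.2 hne
          simp [this]
        · simp
      obtain ⟨g, hg, hgs, hgt⟩ := hlin
      refine ⟨f * g, ?_, by simp [hfs, hgs], ?_⟩
      · rw [Finset.card_insert_of_notMem htT, pow_succ]
        exact Submodule.mul_mem_mul hf hg
      · intro x hx
        rcases Finset.mem_insert.1 hx with rfl | hx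
        · simp [hgt]
        · simp [hfT x hx]
  obtain ⟨f, hf, hfs, hfT⟩ := key (S.erase s) (by simp)
  refine ⟨f, ?_, hfs, fun t ht hts => hfT t (Finset.mem_erase.2 ⟨hts, ht⟩)⟩
  have hc : (S.erase s).card ≤ S.card := Finset.card_le_card (Finset.erase_subset _ _)
  rw [mul_pow] at hf
  exact mul_le_mul' (one_le_pow_of_le h1A (hc.trans hN)) (one_le_pow_of_le h1B (hc.trans hN')) hf

lemma card_add_finrank_le (v : Fin (K + 1) → E → ℝ) (w : Fin (M + 1) → E → ℝ)
    (hv : v 0 = 1) (hw : w 0 = 1)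
    (hsep : ∀ x y, (∀ i, v i x = v i y) → (∀ i, w i x = w i y) → x = y) (S : Finset E)
    {N N₂ : ℕ} (hN : S.card ≤ N) (hN' : S.card ≤ N₂) (W : Submodule ℝ (E → ℝ))
    (hW : W ≤ bigraded v w N N₂) (hWS : ∀ f ∈ W, ∀ s ∈ S, f s = 0) :
    S.card + Module.finrank ℝ W ≤ Module.finrank ℝ (bigraded v w N N₂) := by
  classical
  let ev : bigraded v w N N₂ →ₗ[ℝ] (S → ℝ) :=
    (LinearMap.pi fun s : S => LinearMap.proj (s : E)) ∘ₗ (bigraded v w N N₂).subtype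
  have hsurj : LinearMap.range ev = ⊤ := by
    rw [eq_top_iff, ← (Pi.basisFun ℝ S).span_eq, Submodule.span_le]
    rintro _ ⟨s, rfl⟩
    obtain ⟨f, hf, hfs, hft⟩ :=
      exists_mem_bigraded_eq_single v w hv hw hsep S hN hN' s
    refine ⟨⟨f, hf⟩, ?_⟩
    ext t
    by_cases h : t = s
    · subst h; simp [ev, hfs]
    · have h' : (t : E) ≠ s := fun h' => h (Subtype.ext h')
      simp [ev, hft t t.2 h', h]
  have h1 := ev.finrank_range_add_finrank_ker
  rw [hsurj, finrank_top, Module.finrank_fintype_fun_eq_card, Fintype.card_coe] at h1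
  have h2 : Module.finrank ℝ W ≤ Module.finrank ℝ (LinearMap.ker ev) := by
    have : W ≤ (LinearMap.ker ev).map (bigraded v w N N₂).subtype := by
      intro f hf
      refine ⟨⟨f, hW hf⟩, ?_, rfl⟩
      simp only [SetLike.mem_coe, LinearMap.mem_ker]
      ext s
      exact hWS f hf s s.2
    calc Module.finrank ℝ W ≤ _ := Submodule.finrank_mono this
      _ ≤ _ := Submodule.finrank_map_le _ _
  omega

/-- The map sending multipliers to the corresponding combination of the equations. -/
def combination (v : Fin (K + 1) → E → ℝ) (w : Fin (M + 1) → E → ℝ) (d : Fin n → ℕ × ℕ)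
    (g : Fin n → E → ℝ) (N N₂ : ℕ) :
    (∀ i, bigraded v w (N - (d i).1) (N₂ - (d i).2)) →ₗ[ℝ] (E → ℝ) :=
  ∑ i, LinearMap.mulLeft ℝ (g i) ∘ₗ (Submodule.subtype _) ∘ₗ LinearMap.proj i

lemma combination_apply (v : Fin (K + 1) → E → ℝ) (w : Fin (M + 1) → E → ℝ) (d : Fin n → ℕ × ℕ)
    (g : Fin n → E → ℝ) (N N₂ : ℕ) (h : ∀ i, bigraded v w (N - (d i).1) (N₂ - (d i).2)) :
    combination v w d g N N₂ h = ∑ i, g i * (h i : E → ℝ) := by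
  simp [combination]

/-- The special system made of products of moment forms. -/
def specialSystem (v : Fin (K + 1) → E → ℝ) (w : Fin (M + 1) → E → ℝ) (d : Fin n → ℕ × ℕ)
    (i : Fin n) : E → ℝ :=
  momentForm v ((i : ℕ) : ℝ) ^ (d i).1 * momentForm w ((i : ℕ) : ℝ) ^ (d i).2

lemma specialSystem_mem (v : Fin (K + 1) → E → ℝ) (w : Fin (M + 1) → E → ℝ)
    (d : Fin n → ℕ × ℕ) (i : Fin n) :
    specialSystem v w d i ∈ bigraded v w (d i).1 (d i).2 :=
  Submodule.mul_mem_mul (Submodule.pow_mem_pow _ (momentForm_mem v _) _)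
    (Submodule.pow_mem_pow _ (momentForm_mem w _) _)

lemma exists_finrank_bigraded_le (v : Fin (K + 1) → E → ℝ) (w : Fin (M + 1) → E → ℝ)
    (d : Fin n → ℕ × ℕ) (hn : n = K + M) :
    ∃ N₀, ∀ N ≥ N₀, ∀ N₂ ≥ N₀, Module.finrank ℝ (bigraded v w N N₂) ≤
      mixedBezout K M (List.ofFn d) 0 0 +
        Module.finrank ℝ (LinearMap.range (combination v w d (specialSystem v w d) N N₂)) := by
  let l : List (ℝ × ℕ × ℕ) := List.ofFn fun i : Fin n => (((i : ℕ) : ℝ), d i)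
  have hl : (l.map Prod.fst).Nodup := by
    simp only [l, List.map_ofFn]
    exact List.nodup_ofFn.2 fun i j hij => Fin.ext (by simpa using hij)
  have hlen : l.length = n := by simp [l]
  obtain ⟨N₀, h⟩ := codimLE_mixedBezout (v := v) (w := w) l ∅ ∅ hl (by simp) (by simp [hlen, hn])
  refine ⟨N₀, fun N hN N₂ hN' => ?_⟩
  obtain ⟨T, hT, hle⟩ := h N hN N₂ hN'
  have hsnd : l.map Prod.snd = List.ofFn d := by simp [l, List.map_ofFn, Function.comp_def]
  simp only [hsnd, Finset.card_empty] at hT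
  have hideal : idealPiece v w (singles ∅ ∅ + (l : Multiset (ℝ × ℕ × ℕ))) N N₂ ≤
      LinearMap.range (combination v w d (specialSystem v w d) N N₂) := by
    simp only [idealPiece, singles, Finset.empty_val, Multiset.map_zero, zero_add,
      Multiset.map_coe, Multiset.sum_coe, l, List.map_ofFn, List.sum_ofFn]
    refine Finset.sum_induction _ (· ≤ LinearMap.range _)
      (fun a b ha hb => sup_le ha hb) bot_le fun i _ => ?_
    intro f hf
    obtain ⟨h, hh, rfl⟩ := Submodule.mem_span_singleton_mul.1 hf
    refine ⟨Pi.single i ⟨h, hh⟩, ?_⟩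
    rw [combination_apply, Finset.sum_eq_single i]
    · simp [specialSystem]
    · intro j _ hj
      simp [Pi.single_eq_of_ne hj]
    · simp
  calc Module.finrank ℝ (bigraded v w N N₂)
      ≤ Module.finrank ℝ (Submodule.span ℝ (T : Set (E → ℝ)) ⊔
          LinearMap.range (combination v w d (specialSystem v w d) N N₂) : Submodule ℝ _) :=
        Submodule.finrank_mono (hle.trans (sup_le_sup le_rfl hideal))
    _ ≤ Module.finrank ℝ (Submodule.span ℝ (T : Set (E → ℝ))) + _ :=
        Submodule.finrank_add_le_finrank_add_finrank _ _
    _ ≤ _ := Nat.add_le_add_right ((finrank_span_finset_le_card T).trans hT) _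

/-- Continuously differentiable functions form a subalgebra. -/
def contDiffSubalgebra (E : Type*) [NormedAddCommGroup E] [NormedSpace ℝ E] :
    Subalgebra ℝ (E → ℝ) where
  carrier := {f | ContDiff ℝ 1 f}
  mul_mem' {f g} (hf : ContDiff ℝ 1 f) (hg : ContDiff ℝ 1 g) := hf.mul hg
  add_mem' {f g} (hf : ContDiff ℝ 1 f) (hg : ContDiff ℝ 1 g) := hf.add hg
  algebraMap_mem' c := (contDiff_const : ContDiff ℝ 1 fun _ : E => c)

lemma contDiff_of_mem_bigraded [NormedAddCommGroup E] [NormedSpace ℝ E]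
    {v : Fin (K + 1) → E → ℝ} {w : Fin (M + 1) → E → ℝ} (hv : ∀ i, ContDiff ℝ 1 (v i))
    (hw : ∀ i, ContDiff ℝ 1 (w i)) {N N₂ : ℕ} {f : E → ℝ} (hf : f ∈ bigraded v w N N₂) :
    ContDiff ℝ 1 f := by
  have hsub : ∀ {p : ℕ} (u : Fin (p + 1) → E → ℝ), (∀ i, ContDiff ℝ 1 (u i)) → ∀ N : ℕ,
      Submodule.span ℝ (Set.range u) ^ N ≤ Subalgebra.toSubmodule (contDiffSubalgebra E) := by
    intro p u hu N
    have h1 : Submodule.span ℝ (Set.range u) ≤ Subalgebra.toSubmodule (contDiffSubalgebra E) := by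
      rw [Submodule.span_le]
      rintro _ ⟨i, rfl⟩
      exact hu i
    induction N with
    | zero =>
      rw [pow_zero, Submodule.one_le]
      exact (contDiffSubalgebra E).one_mem
    | succ N ih =>
      rw [pow_succ]
      exact Submodule.mul_le.2 fun a ha b hb => (contDiffSubalgebra E).mul_mem (ih ha) (h1 hb)
  have : bigraded v w N N₂ ≤ Subalgebra.toSubmodule (contDiffSubalgebra E) :=
    Submodule.mul_le.2 fun a ha b hb =>
      (contDiffSubalgebra E).mul_mem (hsub v hv N ha) (hsub w hw N₂ hb)
  exact this hf

lemma eventually_exists_zero [NormedAddCommGroup E] [NormedSpace ℝ E] [FiniteDimensional ℝ E]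
    {F : Type*} [NormedAddCommGroup F] [NormedSpace ℝ F] [FiniteDimensional ℝ F]
    {g h : E → F} (hg : ContDiff ℝ 1 g) (hh : ContDiff ℝ 1 h) {x : E} (hx : g x = 0)
    (hsurj : Function.Surjective (fderiv ℝ g x)) {U : Set E} (hU : U ∈ nhds x) :
    ∀ᶠ τ : ℝ in nhds 0, ∃ y ∈ U, g y + τ • h y = 0 := by
  have : CompleteSpace E := FiniteDimensional.complete ℝ E
  have : CompleteSpace F := FiniteDimensional.complete ℝ F
  let G : ℝ × E → ℝ × F := fun p => (p.1, g p.2 + p.1 • h p.2)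
  have hGc : ContDiff ℝ 1 G := contDiff_fst.prodMk
    ((hg.comp contDiff_snd).add (contDiff_fst.smul (hh.comp contDiff_snd)))
  have hG := (hGc.contDiffAt (x := ((0 : ℝ), x))).hasStrictFDerivAt one_ne_zero
  have hder : HasFDerivAt G ((ContinuousLinearMap.fst ℝ ℝ E).prod
      ((fderiv ℝ g x).comp (ContinuousLinearMap.snd ℝ ℝ E) +
        (ContinuousLinearMap.fst ℝ ℝ E).smulRight (h x))) ((0 : ℝ), x) := by
    have h1 : HasFDerivAt (fun p : ℝ × E => p.1) (ContinuousLinearMap.fst ℝ ℝ E) ((0 : ℝ), x) :=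
      hasFDerivAt_fst
    have h2 : HasFDerivAt (fun p : ℝ × E => p.2) (ContinuousLinearMap.snd ℝ ℝ E) ((0 : ℝ), x) :=
      hasFDerivAt_snd
    have h3 : HasFDerivAt g (fderiv ℝ g x) ((fun p : ℝ × E => p.2) ((0 : ℝ), x)) :=
      ((hg.differentiable one_ne_zero) x).hasFDerivAt
    have h4 : HasFDerivAt h (fderiv ℝ h x) ((fun p : ℝ × E => p.2) ((0 : ℝ), x)) :=
      ((hh.differentiable one_ne_zero) x).hasFDerivAt
    have h5 := h1.prodMk ((h3.comp _ h2).add (h1.smul (h4.comp _ h2)))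
    refine h5.congr_fderiv ?_
    ext p <;> simp
  rw [hder.fderiv] at hG
  have hrange : ((ContinuousLinearMap.fst ℝ ℝ E).prod
      ((fderiv ℝ g x).comp (ContinuousLinearMap.snd ℝ ℝ E) +
        (ContinuousLinearMap.fst ℝ ℝ E).smulRight (h x))).range = ⊤ := by
    rw [LinearMap.range_eq_top]
    rintro ⟨τ, y⟩
    obtain ⟨z, hz⟩ := hsurj (y - τ • h x)
    exact ⟨(τ, z), by simp [hz]⟩
  have hmap := hG.map_nhds_eq_of_surj hrange
  have hmem : G '' (Set.univ ×ˢ U) ∈ nhds (((0 : ℝ), (0 : F))) := by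
    have : G ((0 : ℝ), x) = (0, 0) := by simp [G, hx]
    rw [← this, ← hmap]
    exact Filter.image_mem_map (prod_mem_nhds Filter.univ_mem hU)
  have hcont : Filter.Tendsto (fun τ : ℝ => (τ, (0 : F))) (nhds 0) (nhds ((0 : ℝ), (0 : F))) :=
    (Continuous.prodMk_left (0 : F)).tendsto 0
  filter_upwards [hcont hmem] with τ hτ
  obtain ⟨⟨τ', y⟩, ⟨-, hy⟩, heq⟩ := hτ
  simp only [G, Prod.mk.injEq] at heq
  obtain ⟨rfl, h2⟩ := heq
  exact ⟨y, hy, h2⟩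

/-- A system of equations of given bidegrees has at most as many nondegenerate zeros as the
mixed Bézout number predicts. -/
theorem card_nondegenerate_zeros_le [NormedAddCommGroup E] [NormedSpace ℝ E]
    [FiniteDimensional ℝ E] (v : Fin (K + 1) → E → ℝ) (w : Fin (M + 1) → E → ℝ)
    (hv : v 0 = 1) (hw : w 0 = 1)
    (hsep : ∀ x y, (∀ i, v i x = v i y) → (∀ i, w i x = w i y) → x = y)
    (hvc : ∀ i, ContDiff ℝ 1 (v i)) (hwc : ∀ i, ContDiff ℝ 1 (w i))
    (hn : n = K + M) (d : Fin n → ℕ × ℕ) (g : Fin n → E → ℝ)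
    (hg : ∀ i, g i ∈ bigraded v w (d i).1 (d i).2) (S : Finset E)
    (hS : ∀ x ∈ S, (∀ i, g i x = 0) ∧
      Function.Surjective (fderiv ℝ (fun x => fun i => g i x) x)) :
    S.card ≤ mixedBezout K M (List.ofFn d) 0 0 := by
  classical
  set sp := specialSystem v w d
  have hspm : ∀ i, sp i ∈ bigraded v w (d i).1 (d i).2 := specialSystem_mem v w d
  have hgc : ContDiff ℝ 1 (fun x => fun i => g i x) :=
    contDiff_pi.2 fun i => contDiff_of_mem_bigraded hvc hwc (hg i)
  have hspc : ContDiff ℝ 1 (fun x => fun i => sp i x) :=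
    contDiff_pi.2 fun i => contDiff_of_mem_bigraded hvc hwc (hspm i)
  obtain ⟨N₀, hN₀⟩ := exists_finrank_bigraded_le v w d hn
  obtain ⟨n₁, hn₁⟩ : ∃ n₁, ∀ i, (d i).1 ≤ n₁ ∧ (d i).2 ≤ n₁ :=
    ⟨∑ i, ((d i).1 + (d i).2), fun i => by
      have := Finset.single_le_sum (f := fun i => (d i).1 + (d i).2) (fun _ _ => Nat.zero_le _)
        (Finset.mem_univ i)
      constructor <;> omega⟩
  set N := N₀ + n₁ + S.card
  have hfin := finite_finrank_range_add_smul_lt (combination v w d g N N)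
    (combination v w d sp N N)
  obtain ⟨U, hU, hdisj⟩ := S.finite_toSet.t2_separation
  have hev : ∀ᶠ τ : ℝ in nhds 0, ∀ x ∈ S, ∃ y ∈ U x, ∀ i, g i y + τ * sp i y = 0 := by
    rw [Filter.eventually_all_finset]
    intro x hx
    have := eventually_exists_zero hgc hspc (funext (hS x hx).1) (hS x hx).2
      ((hU x).2.mem_nhds (hU x).1)
    filter_upwards [this] with τ hτ
    obtain ⟨y, hy, h⟩ := hτ
    exact ⟨y, hy, fun i => by simpa using congrFun h i⟩
  have hev2 : ∃ τ : ℝ, (∀ x ∈ S, ∃ y ∈ U x, ∀ i, g i y + τ * sp i y = 0) ∧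
      ¬ (Module.finrank ℝ (LinearMap.range (combination v w d g N N + τ • combination v w d sp N N))
        < Module.finrank ℝ (LinearMap.range (combination v w d sp N N))) := by
    have hinf : (nhdsWithin (0 : ℝ) {0}ᶜ).NeBot := inferInstance
    have h1 := hev.filter_mono (nhdsWithin_le_nhds (s := {0}ᶜ))
    have h2 : ∀ᶠ τ : ℝ in nhdsWithin (0 : ℝ) {0}ᶜ, τ ∉ {τ : ℝ |
        Module.finrank ℝ (LinearMap.range (combination v w d g N N + τ • combination v w d sp N N))
        < Module.finrank ℝ (LinearMap.range (combination v w d sp N N))} :=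
      nhdsNE_le_cofinite 0 hfin.compl_mem_cofinite
    exact (h1.and h2).exists
  obtain ⟨τ, hτ, hrank⟩ := hev2
  choose! y hyU hy using hτ
  have hinj : Set.InjOn y S := by
    intro a ha b hb hab
    by_contra hne
    exact Set.disjoint_left.1 (hdisj ha hb hne) (hyU a ha) (hab ▸ hyU b hb)
  have hcard : (S.image y).card = S.card := Finset.card_image_of_injOn hinj
  have hmain := card_add_finrank_le v w hv hw hsep (S.image y) (N := N) (N₂ := N)
    (by omega) (by omega)
    (LinearMap.range (combination v w d g N N + τ • combination v w d sp N N)) (by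
      rintro _ ⟨h, rfl⟩
      rw [LinearMap.add_apply, LinearMap.smul_apply, combination_apply, combination_apply]
      have hi : ∀ i, (d i).1 ≤ N ∧ (d i).2 ≤ N := fun i =>
        ⟨(hn₁ i).1.trans (by omega), (hn₁ i).2.trans (by omega)⟩
      exact Submodule.add_mem _
        (Submodule.sum_mem _ fun i _ => bigraded_mul_mem (hi i).1 (hi i).2 (hg i) (h i).2)
        (Submodule.smul_mem _ _
          (Submodule.sum_mem _ fun i _ => bigraded_mul_mem (hi i).1 (hi i).2 (hspm i) (h i).2)))
    (by
      rintro _ ⟨h, rfl⟩ s hs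
      obtain ⟨x, hx, rfl⟩ := Finset.mem_image.1 hs
      rw [LinearMap.add_apply, LinearMap.smul_apply, combination_apply, combination_apply]
      simp only [Pi.add_apply, Pi.smul_apply, Finset.sum_apply, Pi.mul_apply, smul_eq_mul,
        Finset.mul_sum, ← Finset.sum_add_distrib]
      refine Finset.sum_eq_zero fun i _ => ?_
      have := hy x hx i
      linear_combination (h i : E → ℝ) (y x) * this)
  have : Module.finrank ℝ (bigraded v w N N) ≤ mixedBezout K M (List.ofFn d) 0 0 +
      Module.finrank ℝ (LinearMap.range (combination v w d sp N N)) :=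
    hN₀ N (by omega) N (by omega)
  omega

end Bezout

section System

variable {k : ℕ}

/-- The differential of a polynomial function. -/
noncomputable def polyDeriv (p : MvPolynomial (Fin k) ℝ) (x : Fin k → ℝ) :
    (Fin k → ℝ) →L[ℝ] ℝ :=
  ∑ i, eval x (pderiv i p) • ContinuousLinearMap.proj i

lemma polyDeriv_apply (p : MvPolynomial (Fin k) ℝ) (x v : Fin k → ℝ) :
    polyDeriv p x v = ∑ i, eval x (pderiv i p) * v i := by
  simp [polyDeriv]

lemma hasStrictFDerivAt_eval (p : MvPolynomial (Fin k) ℝ) (x : Fin k → ℝ) :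
    HasStrictFDerivAt (fun x => eval x p) (polyDeriv p x) x := by
  induction p using MvPolynomial.induction_on with
  | C a =>
    simp only [eval_C]
    refine (hasStrictFDerivAt_const a x).congr_fderiv ?_
    ext v
    simp [polyDeriv_apply]
  | add p q hp hq =>
    simp only [map_add]
    refine (hp.add hq).congr_fderiv ?_
    ext v
    simp [polyDeriv_apply, add_mul, Finset.sum_add_distrib]
  | mul_X p i hp =>
    simp only [map_mul, eval_X]
    refine (hp.mul (ContinuousLinearMap.proj (R := ℝ) (φ := fun _ : Fin k => ℝ)
      i).hasStrictFDerivAt).congr_fderiv ?_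
    ext v
    simp only [add_apply, smul_apply, smul_eq_mul,
      ContinuousLinearMap.proj_apply, polyDeriv_apply, pderiv_mul, map_add, map_mul, eval_X,
      add_mul, Finset.sum_add_distrib, Finset.mul_sum]
    rw [add_comm]
    congr 1
    · exact Finset.sum_congr rfl fun j _ => by ring
    · rw [Finset.sum_eq_single i]
      · simp
      · intro j _ hj
        simp [pderiv_X_of_ne hj.symm]
      · simp

lemma contDiff_eval (p : MvPolynomial (Fin k) ℝ) {n : WithTop ℕ∞} :
    ContDiff ℝ n (fun x => eval x p) := by
  induction p using MvPolynomial.induction_on with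
  | C a => simpa using contDiff_const
  | add p q hp hq => simpa using hp.add hq
  | mul_X p i hp => simpa using hp.mul (contDiff_apply ℝ ℝ i)

lemma continuous_eval' (p : MvPolynomial (Fin k) ℝ) : Continuous fun x : Fin k → ℝ => eval x p :=
  (contDiff_eval p (n := 0)).continuous

lemma totalDegree_pderiv_le (p : MvPolynomial (Fin k) ℝ) (i : Fin k) :
    (pderiv i p).totalDegree ≤ p.totalDegree - 1 := by
  refine Finset.sup_le fun m hm => ?_
  rw [mem_support_iff, coeff_pderiv] at hm
  have h := le_totalDegree (mem_support_iff.2 (left_ne_zero_of_mul hm))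
  rw [Finsupp.sum_add_index' (fun _ => rfl) (fun _ _ _ => rfl), Finsupp.sum_single_index rfl] at h
  omega

lemma mixedBezout_replicate_right {K M : ℕ} (e n p q : ℕ) (h : p + q + n = K + M) :
    mixedBezout K M (List.replicate n (e, 1)) p q =
      if p ≤ K then n.choose (K - p) * e ^ (K - p) else 0 := by
  induction n generalizing p q with
  | zero =>
    simp only [List.replicate_zero, mixedBezout]
    by_cases hp : p = K
    · subst hp
      have : q = M := by omega
      simp [this]
    · by_cases hp' : p ≤ K
      · have : K - p ≠ 0 := by omega
        rw [if_neg (by omega), if_pos hp', Nat.choose_eq_zero_of_lt (by omega), zero_mul]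
      · rw [if_neg (by omega), if_neg hp']
  | succ n ih =>
    rw [List.replicate_succ, mixedBezout, ih _ _ (by omega), ih _ _ (by omega)]
    by_cases hp : p ≤ K
    · rcases hp.eq_or_lt with rfl | hp'
      · simp
      · obtain ⟨j, rfl⟩ : ∃ j, K = p + 1 + j := ⟨K - (p + 1), by omega⟩
        have h1 : p + 1 + j - (p + 1) = j := by omega
        have h2 : p + 1 + j - p = j + 1 := by omega
        rw [if_pos (by omega), if_pos hp, if_pos hp, h1, h2, Nat.choose_succ_succ]
        ring
    · rw [if_neg (by omega), if_neg hp, if_neg hp]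
      simp

lemma mixedBezout_append_left {K M : ℕ} (l : List ℕ) (l' : List (ℕ × ℕ)) (p q : ℕ) :
    mixedBezout K M (l.map (fun d => (d, 0)) ++ l') p q =
      l.prod * mixedBezout K M l' (p + l.length) q := by
  induction l generalizing p with
  | nil => simp
  | cons d l ih =>
    rw [List.map_cons, List.cons_append, mixedBezout, ih, List.prod_cons, List.length_cons]
    rw [show p + 1 + l.length = p + (l.length + 1) by ring]
    ring

lemma eval_mem_pow {E : Type*} (φ : E → Fin k → ℝ) (v : Fin (k + 1) → E → ℝ) (hv0 : v 0 = 1)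
    (hv : ∀ i : Fin k, v i.succ = fun z => φ z i) (p : MvPolynomial (Fin k) ℝ) {d : ℕ}
    (hd : p.totalDegree ≤ d) :
    (fun z => eval (φ z) p) ∈ Submodule.span ℝ (Set.range v) ^ d := by
  set A := Submodule.span ℝ (Set.range v)
  have h1A : (1 : Submodule ℝ (E → ℝ)) ≤ A := by
    rw [Submodule.one_eq_span, Submodule.span_singleton_le_iff_mem, ← hv0]
    exact Submodule.subset_span ⟨0, rfl⟩
  have hmon : ∀ s : Fin k →₀ ℕ, (∏ i, (fun z => φ z i) ^ s i : E → ℝ) ∈ A ^ (∑ i, s i) := by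
    intro s
    rw [← Finset.prod_pow_eq_pow_sum]
    have hi : ∀ i, (fun z => φ z i) ^ s i ∈ A ^ s i := fun i =>
      Submodule.pow_mem_pow _ (hv i ▸ Submodule.subset_span ⟨i.succ, rfl⟩) _
    induction (Finset.univ : Finset (Fin k)) using Finset.induction with
    | empty => exact Submodule.one_le.1 le_rfl
    | insert a t ha ih =>
      rw [Finset.prod_insert ha, Finset.prod_insert ha]
      exact Submodule.mul_mem_mul (hi a) ih
  have hsum : (fun z => eval (φ z) p) =
      ∑ s ∈ p.support, p.coeff s • (∏ i, (fun z => φ z i) ^ s i : E → ℝ) := by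
    ext z
    simp [eval_eq', Finset.sum_apply, Finset.prod_apply]
  rw [hsum]
  refine Submodule.sum_mem _ fun s hs => Submodule.smul_mem _ _ ?_
  refine one_le_pow_of_le h1A ?_ (hmon s)
  have := (le_totalDegree hs).trans hd
  rwa [Finsupp.sum_fintype _ _ (fun _ => rfl)] at this

/-- The number of nondegenerate solutions of a system consisting of equations in `x` and of
equations which are affine in additional unknowns `y`. -/
theorem card_nondegenerate_lagrange_le {μ : Type*} [Fintype μ] (p : μ → MvPolynomial (Fin k) ℝ)
    (F : Fin k → MvPolynomial (Fin k) ℝ) (G : Fin k → μ → MvPolynomial (Fin k) ℝ)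
    (d : μ → ℕ) (e : ℕ) (hp : ∀ s, (p s).totalDegree ≤ d s) (hF : ∀ i, (F i).totalDegree ≤ e)
    (hG : ∀ i s, (G i s).totalDegree ≤ e) (T : Finset ((Fin k → ℝ) × (μ → ℝ)))
    (hzero : ∀ z ∈ T, (∀ s, eval z.1 (p s) = 0) ∧
      ∀ i, eval z.1 (F i) - ∑ s, z.2 s * eval z.1 (G i s) = 0)
    (hinj : ∀ z ∈ T, ∀ v : (Fin k → ℝ) × (μ → ℝ), (∀ s, polyDeriv (p s) z.1 v.1 = 0) →
      (∀ i, polyDeriv (F i) z.1 v.1 -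
        ∑ s, (z.2 s * polyDeriv (G i s) z.1 v.1 + v.2 s * eval z.1 (G i s)) = 0) → v = 0) :
    T.card ≤ (∏ s, d s) * (k.choose (Fintype.card μ) * e ^ (k - Fintype.card μ)) := by
  classical
  set m := Fintype.card μ with hm
  let ε : Fin m ≃ μ := (Fintype.equivFin μ).symm
  let v : Fin (k + 1) → (Fin k → ℝ) × (μ → ℝ) → ℝ := Fin.cons 1 fun i z => z.1 i
  let w : Fin (m + 1) → (Fin k → ℝ) × (μ → ℝ) → ℝ := Fin.cons 1 fun j z => z.2 (ε j)
  have hv0 : v 0 = 1 := rfl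
  have hw0 : w 0 = 1 := rfl
  have hvs : ∀ i : Fin k, v i.succ = fun z => z.1 i := fun i => rfl
  have hws : ∀ j : Fin m, w j.succ = fun z => z.2 (ε j) := fun j => rfl
  let g₁ : Fin m → (Fin k → ℝ) × (μ → ℝ) → ℝ := fun j z => eval z.1 (p (ε j))
  let g₂ : Fin k → (Fin k → ℝ) × (μ → ℝ) → ℝ :=
    fun i z => eval z.1 (F i) - ∑ s, z.2 s * eval z.1 (G i s)
  let D : Fin (m + k) → ℕ × ℕ := Fin.append (fun j => (d (ε j), 0)) fun _ => (e, 1)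
  let g : Fin (m + k) → (Fin k → ℝ) × (μ → ℝ) → ℝ := Fin.append g₁ g₂
  have h1B : (1 : Submodule ℝ ((Fin k → ℝ) × (μ → ℝ) → ℝ)) ≤
      Submodule.span ℝ (Set.range w) := by
    rw [Submodule.one_eq_span, Submodule.span_singleton_le_iff_mem, ← hw0]
    exact Submodule.subset_span ⟨0, rfl⟩
  have hgm : ∀ i, g i ∈ bigraded v w (D i).1 (D i).2 := by
    intro i
    refine Fin.addCases (fun j => ?_) (fun j => ?_) i
    · simp only [g, D, Fin.append_left, bigraded, pow_zero, mul_one]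
      exact eval_mem_pow Prod.fst v hv0 hvs _ (hp _)
    · simp only [g, D, Fin.append_right, bigraded, pow_one]
      have h1 : g₂ j = (fun z => eval z.1 (F j)) * 1 -
          ∑ s, (fun z => eval z.1 (G j s)) * w (ε.symm s).succ := by
        ext z
        simp only [g₂, hws, Pi.sub_apply, Pi.mul_apply, Finset.sum_apply, mul_one,
          Equiv.apply_symm_apply]
        simp only [mul_comm]
      rw [h1]
      refine Submodule.sub_mem _ (Submodule.mul_mem_mul ?_ (Submodule.one_le.1 h1B))
        (Submodule.sum_mem _ fun s _ => Submodule.mul_mem_mul ?_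
          (Submodule.subset_span ⟨_, rfl⟩))
      · exact eval_mem_pow Prod.fst v hv0 hvs _ (hF _)
      · exact eval_mem_pow Prod.fst v hv0 hvs _ (hG _ _)
  have hfst : ∀ (q : MvPolynomial (Fin k) ℝ) (z : (Fin k → ℝ) × (μ → ℝ)),
      HasFDerivAt (fun z : (Fin k → ℝ) × (μ → ℝ) => eval z.1 q)
        ((polyDeriv q z.1).comp (ContinuousLinearMap.fst ℝ _ _)) z := fun q z =>
    (hasStrictFDerivAt_eval q z.1).hasFDerivAt.comp z hasFDerivAt_fst
  have hg₂ : ∀ (i : Fin k) (z : (Fin k → ℝ) × (μ → ℝ)),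
      HasFDerivAt (g₂ i) ((polyDeriv (F i) z.1).comp (ContinuousLinearMap.fst ℝ _ _) -
        ∑ s, (z.2 s • (polyDeriv (G i s) z.1).comp (ContinuousLinearMap.fst ℝ _ _) +
          eval z.1 (G i s) • (ContinuousLinearMap.proj s).comp
            (ContinuousLinearMap.snd ℝ (Fin k → ℝ) (μ → ℝ)))) z := by
    intro i z
    refine (hfst (F i) z).sub (HasFDerivAt.fun_sum fun s _ => ?_)
    exact (((ContinuousLinearMap.proj s).comp
      (ContinuousLinearMap.snd ℝ (Fin k → ℝ) (μ → ℝ))).hasFDerivAt (x := z)).mul (hfst (G i s) z)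
  have hdiff : ∀ z, HasFDerivAt (fun z i => g i z) (ContinuousLinearMap.pi fun i =>
      fderiv ℝ (g i) z) z := by
    intro z
    refine hasFDerivAt_pi.2 fun i => ?_
    have : ContDiff ℝ 1 (g i) := contDiff_of_mem_bigraded (v := v) (w := w)
      (fun i => Fin.cases contDiff_const (fun i => by rw [hvs]; fun_prop) i)
      (fun i => Fin.cases contDiff_const (fun i => by rw [hws]; fun_prop) i) (hgm i)
    exact (this.differentiable one_ne_zero z).hasFDerivAt
  have hmain := card_nondegenerate_zeros_le v w hv0 hw0
    (fun x y hx hy => Prod.ext (funext fun i => by simpa [hvs] using hx i.succ)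
      (funext fun s => by simpa [hws] using hy (ε.symm s).succ))
    (fun i => Fin.cases contDiff_const (fun i => by rw [hvs]; fun_prop) i)
    (fun i => Fin.cases contDiff_const (fun i => by rw [hws]; fun_prop) i)
    (add_comm m k) D g hgm T (fun z hz => ⟨fun i => ?_, ?_⟩)
  · refine hmain.trans_eq ?_
    have hD : List.ofFn D = (List.ofFn fun j => d (ε j)).map (fun d => (d, 0)) ++
        List.replicate k (e, 1) := by
      simp only [D, List.ofFn_fin_append, List.map_ofFn, List.ofFn_const]
      rfl
    rw [hD, mixedBezout_append_left, List.prod_ofFn, Equiv.prod_comp ε d, List.length_ofFn,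
      zero_add, mixedBezout_replicate_right _ _ _ _ (by omega)]
    split_ifs with h
    · rw [Nat.choose_symm h]
    · rw [Nat.choose_eq_zero_of_lt (by omega), zero_mul]
  · refine Fin.addCases (fun j => ?_) (fun j => ?_) i
    · simpa [g, g₁] using (hzero z hz).1 (ε j)
    · simpa [g, g₂] using (hzero z hz).2 j
  · rw [(hdiff z).fderiv]
    set L := ContinuousLinearMap.pi fun i => fderiv ℝ (g i) z
    have hrank : Module.finrank ℝ ((Fin k → ℝ) × (μ → ℝ)) =
        Module.finrank ℝ (Fin (m + k) → ℝ) := by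
      simp [m, add_comm]
    refine (LinearMap.injective_iff_surjective_of_finrank_eq_finrank
      (f := (L : ((Fin k → ℝ) × (μ → ℝ)) →ₗ[ℝ] (Fin (m + k) → ℝ))) hrank).1 ?_
    refine (injective_iff_map_eq_zero _).2 fun u hu => hinj z hz u (fun s => ?_) fun i => ?_
    · have h1 := congrFun hu (Fin.castAdd k (ε.symm s))
      have h2 : g (Fin.castAdd k (ε.symm s)) = fun z => eval z.1 (p s) := by
        simp [g, g₁]
      simp only [L, ContinuousLinearMap.coe_coe, ContinuousLinearMap.coe_pi', h2,
        (hfst (p s) z).fderiv] at h1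
      simpa using h1
    · have h1 := congrFun hu (Fin.natAdd m i)
      have h2 : g (Fin.natAdd m i) = g₂ i := by simp [g]
      simp only [L, ContinuousLinearMap.coe_coe, ContinuousLinearMap.coe_pi', h2,
        (hg₂ i z).fderiv] at h1
      simpa [mul_comm] using h1

end System

section Generic

open MeasureTheory

lemma ae_injective_fderiv {E : Type*} [NormedAddCommGroup E] [NormedSpace ℝ E]
    [FiniteDimensional ℝ E] [MeasurableSpace E] [BorelSpace E] (μ : Measure E)
    [μ.IsAddHaarMeasure] {f : E → E} (hf : Differentiable ℝ f) :
    ∀ᵐ e ∂μ, ∀ z, f z = e → Function.Injective (fderiv ℝ f z) := by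
  have h := addHaar_image_eq_zero_of_det_fderivWithin_eq_zero μ (f := f)
    (s := {z | (fderiv ℝ f z).det = 0}) (f' := fderiv ℝ f)
    (fun x _ => (hf x).hasFDerivAt.hasFDerivWithinAt) (fun x hx => hx)
  filter_upwards [measure_eq_zero_iff_ae_notMem.1 h] with e he z hz
  have hdet : (fderiv ℝ f z).det ≠ 0 := fun h0 => he ⟨z, h0, hz⟩
  rw [ContinuousLinearMap.det] at hdet
  have hu := LinearMap.isUnit_iff_isUnit_det (fderiv ℝ f z : E →ₗ[ℝ] E) |>.2
    (isUnit_iff_ne_zero.2 hdet)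
  exact ((Module.End.isUnit_iff _).1 hu).1

variable {k : ℕ} {S : Type*} [Fintype S]

/-- The sum of a polynomial and a linear form. -/
noncomputable def tilt (p : MvPolynomial (Fin k) ℝ) (a : Fin k → ℝ) : MvPolynomial (Fin k) ℝ :=
  p + ∑ i, C (a i) * X i

lemma eval_tilt (p : MvPolynomial (Fin k) ℝ) (a x : Fin k → ℝ) :
    eval x (tilt p a) = eval x p + ∑ i, a i * x i := by
  simp [tilt]

lemma pderiv_tilt (p : MvPolynomial (Fin k) ℝ) (a : Fin k → ℝ) (i : Fin k) :
    pderiv i (tilt p a) = pderiv i p + C (a i) := by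
  simp [tilt, pderiv_X, Pi.single_apply]

lemma totalDegree_tilt_le (p : MvPolynomial (Fin k) ℝ) (a : Fin k → ℝ) :
    (tilt p a).totalDegree ≤ max p.totalDegree 1 := by
  refine (totalDegree_add _ _).trans (max_le_max le_rfl ?_)
  refine totalDegree_finsetSum_le fun i _ => ?_
  exact (totalDegree_mul _ _).trans (by simp)

lemma totalDegree_pderiv_tilt_le (p : MvPolynomial (Fin k) ℝ) (a : Fin k → ℝ) (i : Fin k) :
    (pderiv i (tilt p a)).totalDegree ≤ p.totalDegree - 1 := by
  rw [pderiv_tilt]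
  refine (totalDegree_add _ _).trans (max_le (totalDegree_pderiv_le p i) ?_)
  simp

lemma polyDeriv_add_C (p : MvPolynomial (Fin k) ℝ) (c : ℝ) (x : Fin k → ℝ) :
    polyDeriv (p + C c) x = polyDeriv p x := by
  simp [polyDeriv]

@[fun_prop]
lemma differentiable_eval_comp {E : Type*} [NormedAddCommGroup E] [NormedSpace ℝ E]
    (p : MvPolynomial (Fin k) ℝ) {f : E → Fin k → ℝ} (hf : Differentiable ℝ f) :
    Differentiable ℝ fun z => eval (f z) p :=
  ((contDiff_eval p (n := 1)).differentiable one_ne_zero).comp hf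

variable (k S) in
/-- Linear perturbations of the constraints, values of the constraints, and a linear perturbation
of the objective. -/
abbrev Params := (S → Fin k → ℝ) × (S → ℝ) × (Fin k → ℝ)

instance : (volume : Measure (Params k S)).IsAddHaarMeasure :=
  have : (volume : Measure (S → Fin k → ℝ)).IsAddHaarMeasure :=
    Measure.pi.isAddHaarMeasure fun _ => volume
  have : (volume : Measure ((S → ℝ) × (Fin k → ℝ))).IsAddHaarMeasure :=
    Measure.prod.instIsAddHaarMeasure _ _
  Measure.prod.instIsAddHaarMeasure _ _

variable [DecidableEq S]

/-- The map whose values are the parameters admitting multipliers without objective term, with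
multiplier `1` at `s₀`. -/
noncomputable def abnormalMap (g : S → MvPolynomial (Fin k) ℝ) (J : Finset S) (s₀ : S)
    (π : Params k S) : Params k S :=
  let a' : S → Fin k → ℝ := fun s => if s = s₀ then fun i => -eval π.2.2 (pderiv i (g s₀)) -
    ∑ s ∈ J.erase s₀, π.2.1 s * (eval π.2.2 (pderiv i (g s)) + π.1 s i) else π.1 s
  (a', fun s => if s ∈ J then eval π.2.2 (g s) + ∑ i, a' s i * π.2.2 i else π.2.1 s, π.1 s₀)

lemma differentiable_abnormalMap (g : S → MvPolynomial (Fin k) ℝ) (J : Finset S) (s₀ : S) :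
    Differentiable ℝ (abnormalMap g J s₀) := by
  have ha : ∀ s, Differentiable ℝ fun π : Params k S => (abnormalMap g J s₀ π).1 s := by
    intro s
    simp only [abnormalMap]
    split_ifs
    · refine differentiable_pi.2 fun i => ?_
      fun_prop
    · fun_prop
  have ha' : ∀ s i, Differentiable ℝ fun π : Params k S => (abnormalMap g J s₀ π).1 s i :=
    fun s i => differentiable_pi.1 (ha s) i
  refine (differentiable_pi.2 ha).prodMk
    (Differentiable.prodMk (differentiable_pi.2 fun s => ?_) ?_)
  · split_ifs
    · refine Differentiable.add (by fun_prop) (Differentiable.fun_sum fun i _ => ?_)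
      exact (ha' s i).mul (by fun_prop)
    · fun_prop
  · fun_prop

lemma ae_no_abnormal (g : S → MvPolynomial (Fin k) ℝ) :
    ∀ᵐ π : Params k S, ∀ J : Finset S, ∀ s₀ ∈ J, ∀ x : Fin k → ℝ, ∀ y : S → ℝ, y s₀ = 1 →
      (∀ s ∈ J, eval x (tilt (g s) (π.1 s)) = π.2.1 s) →
      (∀ i, ∑ s ∈ J, y s * eval x (pderiv i (tilt (g s) (π.1 s))) = 0) → False := by
  rw [ae_all_iff]
  intro J
  rw [ae_all_iff]
  intro s₀
  filter_upwards [ae_injective_fderiv volume (differentiable_abnormalMap g J s₀)] with π hπ hs₀ x y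
    hy hc hd
  obtain ⟨a, c, b⟩ := π
  simp only [eval_tilt, pderiv_tilt, map_add, eval_C] at hc hd
  let z : Params k S := (Function.update a s₀ b, fun s => if s ∈ J then y s else c s, x)
  have hz : abnormalMap g J s₀ z = (a, c, b) := by
    have ha : (abnormalMap g J s₀ z).1 = a := by
      funext s i
      by_cases hs : s = s₀
      · subst hs
        have h1 := hd i
        rw [← Finset.add_sum_erase _ _ hs₀, hy, one_mul] at h1
        simp only [abnormalMap, if_true, z]
        have h2 : ∑ s' ∈ J.erase s, (if s' ∈ J then y s' else c s') *
            (eval x (pderiv i (g s')) + Function.update a s b s' i) =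
            ∑ s' ∈ J.erase s, y s' * (eval x (pderiv i (g s')) + a s' i) := by
          refine Finset.sum_congr rfl fun s' hs' => ?_
          rw [if_pos (Finset.mem_of_mem_erase hs'),
            Function.update_of_ne (Finset.ne_of_mem_erase hs')]
        rw [h2]
        linarith
      · simp [abnormalMap, hs, z]
    refine Prod.ext ha (Prod.ext (funext fun s => ?_) ?_)
    · change (if s ∈ J then eval x (g s) + ∑ i, (abnormalMap g J s₀ z).1 s i * x i
        else if s ∈ J then y s else c s) = c s
      rw [ha]
      split_ifs with h
      · exact hc s h
      · rfl
    · simp [abnormalMap, z]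
  have hinj := hπ z hz
  let v : Params k S := (0, Pi.single s₀ 1, 0)
  have hconst : ∀ t : ℝ, abnormalMap g J s₀ (z + t • v) = abnormalMap g J s₀ z := by
    intro t
    have h0 : (z + t • v).1 = z.1 := by simp [v]
    have h2 : (z + t • v).2.2 = z.2.2 := by simp [v]
    have h1 : ∀ s, s ≠ s₀ → (z + t • v).2.1 s = z.2.1 s := fun s hs => by simp [v, hs]
    have hsum : ∀ i, ∑ s ∈ J.erase s₀, (z + t • v).2.1 s *
        (eval z.2.2 (pderiv i (g s)) + z.1 s i) =
        ∑ s ∈ J.erase s₀, z.2.1 s * (eval z.2.2 (pderiv i (g s)) + z.1 s i) := fun i =>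
      Finset.sum_congr rfl fun s hs => by rw [h1 s (Finset.ne_of_mem_erase hs)]
    unfold abnormalMap
    simp only [h0, h2, hsum]
    refine Prod.ext rfl (Prod.ext (funext fun s => ?_) rfl)
    by_cases hs : s ∈ J
    · simp [hs]
    · have : s ≠ s₀ := fun h => hs (h ▸ hs₀)
      simp only [if_neg hs, h1 s this]
  have hzero : fderiv ℝ (abnormalMap g J s₀) z v = 0 := by
    have h1 := (differentiable_abnormalMap g J s₀ z).hasFDerivAt.hasLineDerivAt v
    have h2 : HasLineDerivAt ℝ (abnormalMap g J s₀) 0 z v := by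
      unfold HasLineDerivAt
      simp only [hconst]
      exact hasDerivAt_const _ _
    exact h1.unique h2
  have hv : v = 0 := hinj (hzero.trans (map_zero _).symm)
  have := congrFun (congrArg (fun π : Params k S => π.2.1) hv) s₀
  simp [v] at this

/-- The map whose values are the parameters admitting a critical point with given multipliers. -/
noncomputable def criticalMap (g : S → MvPolynomial (Fin k) ℝ) (Φ : MvPolynomial (Fin k) ℝ)
    (J : Finset S) (π : Params k S) : Params k S :=
  (π.1, fun s => if s ∈ J then eval π.2.2 (g s) + ∑ i, π.1 s i * π.2.2 i else π.2.1 s,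
    fun i => eval π.2.2 (pderiv i Φ) -
      ∑ s ∈ J, π.2.1 s * (eval π.2.2 (pderiv i (g s)) + π.1 s i))

lemma differentiable_criticalMap (g : S → MvPolynomial (Fin k) ℝ) (Φ : MvPolynomial (Fin k) ℝ)
    (J : Finset S) : Differentiable ℝ (criticalMap g Φ J) := by
  refine Differentiable.prodMk (by fun_prop) (Differentiable.prodMk
    (differentiable_pi.2 fun s => ?_) (differentiable_pi.2 fun i => by fun_prop))
  split_ifs <;> fun_prop

lemma hasDerivAt_eval_line (p : MvPolynomial (Fin k) ℝ) (x v : Fin k → ℝ) :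
    HasDerivAt (fun t : ℝ => eval (x + t • v) p) (polyDeriv p x v) 0 :=
  (hasStrictFDerivAt_eval p x).hasFDerivAt.hasLineDerivAt v

lemma ae_nondegenerate (g : S → MvPolynomial (Fin k) ℝ) (Φ : MvPolynomial (Fin k) ℝ) :
    ∀ᵐ π : Params k S, ∀ J : Finset S, ∀ x : Fin k → ℝ, ∀ y : S → ℝ,
      (∀ s ∈ J, eval x (tilt (g s) (π.1 s)) = π.2.1 s) →
      (∀ i, eval x (pderiv i (tilt Φ (-π.2.2))) -
        ∑ s ∈ J, y s * eval x (pderiv i (tilt (g s) (π.1 s))) = 0) →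
      ∀ (v : Fin k → ℝ) (u : S → ℝ), (∀ s ∉ J, u s = 0) →
      (∀ s ∈ J, polyDeriv (tilt (g s) (π.1 s)) x v = 0) →
      (∀ i, polyDeriv (pderiv i (tilt Φ (-π.2.2))) x v -
        ∑ s ∈ J, (y s * polyDeriv (pderiv i (tilt (g s) (π.1 s))) x v +
          u s * eval x (pderiv i (tilt (g s) (π.1 s)))) = 0) → v = 0 ∧ u = 0 := by
  rw [ae_all_iff]
  intro J
  filter_upwards [ae_injective_fderiv volume (differentiable_criticalMap g Φ J)] with π hπ x y
    hc hd v u hu hv hvu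
  obtain ⟨a, c, b⟩ := π
  simp only at hc hd hv hvu
  let z : Params k S := (a, fun s => if s ∈ J then y s else c s, x)
  have hz : criticalMap g Φ J z = (a, c, b) := by
    refine Prod.ext rfl (Prod.ext (funext fun s => ?_) (funext fun i => ?_))
    · simp only [criticalMap, z]
      split_ifs with h
      · rw [← hc s h, eval_tilt]
      · rfl
    · have := hd i
      simp only [pderiv_tilt, map_add, eval_C, Pi.neg_apply] at this
      simp only [criticalMap, z]
      rw [Finset.sum_congr rfl fun s hs => by rw [if_pos hs]]
      linarith
  have hinj := hπ z hz
  let w : Params k S := (0, u, v)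
  have hzero : fderiv ℝ (criticalMap g Φ J) z w = 0 := by
    have h1 := (differentiable_criticalMap g Φ J z).hasFDerivAt.hasLineDerivAt w
    have h2 : HasLineDerivAt ℝ (criticalMap g Φ J) 0 z w := by
      unfold HasLineDerivAt criticalMap
      refine HasDerivAt.prodMk (f₁' := 0) ?_ (HasDerivAt.prodMk (f₁' := 0) (f₂' := 0)
        (hasDerivAt_pi.2 fun s => ?_) (hasDerivAt_pi.2 fun i => ?_))
      · simpa [z, w] using hasDerivAt_const (0 : ℝ) a
      · simp only [z, w, Prod.fst_add, Prod.snd_add, Prod.smul_fst, Prod.smul_snd, smul_zero,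
          add_zero, ← eval_tilt]
        split_ifs with h
        · refine HasDerivAt.congr_deriv (f' := polyDeriv (tilt (g s) (a s)) x v) ?_ (hv s h)
          exact hasDerivAt_eval_line _ x v
        · simpa [h, hu s h] using hasDerivAt_const (0 : ℝ) (c s)
      · simp only [z, w, Prod.fst_add, Prod.snd_add, Prod.smul_fst, Prod.smul_snd, smul_zero,
          add_zero]
        have h3 := hvu i
        simp only [pderiv_tilt, polyDeriv_add_C, map_add, eval_C] at h3
        refine HasDerivAt.congr_deriv ?_ h3
        refine (hasDerivAt_eval_line _ x v).sub (HasDerivAt.fun_sum fun s hs => ?_)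
        have h4 : HasDerivAt (fun t : ℝ => y s + t * u s) (u s) 0 := by
          simpa using ((hasDerivAt_id (0 : ℝ)).mul_const (u s)).const_add (y s)
        have h5 := h4.mul ((hasDerivAt_eval_line (pderiv i (g s)) x v).add_const (a s i))
        simp only [zero_smul, add_zero, zero_mul] at h5
        simp only [Pi.add_apply, Pi.smul_apply, smul_eq_mul, if_pos hs]
        exact h5.congr_deriv (by ring)
    exact h1.unique h2
  have hw : w = 0 := hinj (hzero.trans (map_zero _).symm)
  exact ⟨congrArg (fun π : Params k S => π.2.2) hw, congrArg (fun π : Params k S => π.2.1) hw⟩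

/-- For generic linear perturbations, the number of constrained local extrema is bounded by a
Bézout number. -/
theorem ae_card_extr_le (g : S → MvPolynomial (Fin k) ℝ) (Φ : MvPolynomial (Fin k) ℝ) :
    ∀ᵐ π : Params k S, ∀ (J : Finset S) (d : S → ℕ) (e : ℕ),
      (∀ s ∈ J, (g s).totalDegree ≤ d s ∧ 1 ≤ d s ∧ (g s).totalDegree - 1 ≤ e) →
      Φ.totalDegree - 1 ≤ e → ∀ T : Finset (Fin k → ℝ),
      (∀ x ∈ T, (∀ s ∈ J, eval x (tilt (g s) (π.1 s)) = π.2.1 s) ∧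
        IsLocalExtrOn (fun z => eval z (tilt Φ (-π.2.2)))
          {z | ∀ s ∈ J, eval z (tilt (g s) (π.1 s)) = π.2.1 s} x) →
      T.card ≤ (∏ s ∈ J, d s) * (k.choose J.card * e ^ (k - J.card)) := by
  filter_upwards [ae_no_abnormal g, ae_nondegenerate g Φ] with π h1 h2 J d e hg hΦ T hT
  obtain ⟨a, c, b⟩ := π
  simp only at h1 h2 hT
  have hmult : ∀ x ∈ T, ∃ y : J → ℝ, ∀ i, eval x (pderiv i (tilt Φ (-b))) -
      ∑ s : J, y s * eval x (pderiv i (tilt (g s) (a s))) = 0 := by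
    intro x hx
    obtain ⟨hxc, hext⟩ := hT x hx
    have hset : {z | ∀ s ∈ J, eval z (tilt (g s) (a s)) = c s} =
        {z | ∀ s : J, eval z (tilt (g s) (a s)) = eval x (tilt (g s) (a s))} := by
      ext z
      simp only [Set.mem_ofPred_eq, Subtype.forall]
      exact forall₂_congr fun s hs => by rw [hxc s hs]
    rw [hset] at hext
    obtain ⟨Λ, Λ₀, hne, hsum⟩ := hext.exists_multipliers_of_hasStrictFDerivAt
      (f := fun (s : J) z => eval z (tilt (g s) (a s)))
      (fun s => hasStrictFDerivAt_eval (tilt (g s) (a s)) x)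
      (hasStrictFDerivAt_eval (tilt Φ (-b)) x)
    have hsum' : ∀ i, ∑ s : J, Λ s * eval x (pderiv i (tilt (g s) (a s))) +
        Λ₀ * eval x (pderiv i (tilt Φ (-b))) = 0 := by
      intro i
      have hp : ∀ p : MvPolynomial (Fin k) ℝ,
          polyDeriv p x (Pi.single i 1) = eval x (pderiv i p) := fun p => by
        simp [polyDeriv_apply, Pi.single_apply]
      have := congrArg (fun L : (Fin k → ℝ) →L[ℝ] ℝ => L (Pi.single i 1)) hsum
      simpa [hp] using this
    by_cases hΛ₀ : Λ₀ = 0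
    · exfalso
      have hΛ : ∃ s, Λ s ≠ 0 := by
        by_contra! hcon
        exact hne (by rw [Prod.mk_eq_zero]; exact ⟨funext hcon, hΛ₀⟩)
      obtain ⟨s₀, hs₀⟩ := hΛ
      refine h1 J s₀ s₀.2 x (fun s => if h : s ∈ J then Λ ⟨s, h⟩ / Λ s₀ else 0)
        (by simp [hs₀]) hxc fun i => ?_
      have h3 := hsum' i
      rw [hΛ₀, zero_mul, add_zero] at h3
      rw [← Finset.sum_coe_sort]
      have : ∀ s : J, (if h : (s : S) ∈ J then Λ ⟨s, h⟩ / Λ s₀ else 0) *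
          eval x (pderiv i (tilt (g s) (a s))) =
          (Λ s * eval x (pderiv i (tilt (g s) (a s)))) * (Λ s₀)⁻¹ := fun s => by
        rw [dif_pos s.2]; ring
      rw [Finset.sum_congr rfl fun s _ => this s, ← Finset.sum_mul, h3, zero_mul]
    · refine ⟨fun s => -(Λ s) / Λ₀, fun i => ?_⟩
      have h3 := hsum' i
      have : ∀ s : J, -(Λ s) / Λ₀ * eval x (pderiv i (tilt (g s) (a s))) =
          (Λ s * eval x (pderiv i (tilt (g s) (a s)))) * (-(Λ₀)⁻¹) := fun s => by ring
      rw [Finset.sum_congr rfl fun s _ => this s, ← Finset.sum_mul]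
      field_simp
      linarith
  choose! y hy using hmult
  have hinj : Set.InjOn (fun x => (x, y x)) (T : Set (Fin k → ℝ)) :=
    fun x _ x' _ h => congrArg Prod.fst h
  have hcard := card_nondegenerate_lagrange_le (μ := J)
    (fun s => tilt (g s) (a s) - C (c s)) (fun i => pderiv i (tilt Φ (-b)))
    (fun i s => pderiv i (tilt (g s) (a s))) (fun s => d s) e
    (fun s => (totalDegree_sub_C_le _ _).trans ((totalDegree_tilt_le _ _).trans
      (max_le (hg s s.2).1 (hg s s.2).2.1)))
    (fun i => (totalDegree_pderiv_tilt_le _ _ _).trans hΦ)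
    (fun i s => (totalDegree_pderiv_tilt_le _ _ _).trans (hg s s.2).2.2)
    (T.image fun x => (x, y x)) ?_ ?_
  · rw [Finset.card_image_of_injOn hinj, Fintype.card_coe, Finset.prod_coe_sort] at hcard
    exact hcard
  · intro z hz
    obtain ⟨x, hx, rfl⟩ := Finset.mem_image.1 hz
    exact ⟨fun s => by simp [(hT x hx).1 s s.2], hy x hx⟩
  · rintro z hz ⟨v, u⟩ hv hvu
    obtain ⟨x, hx, rfl⟩ := Finset.mem_image.1 hz
    have hext : ∀ (q : J → ℝ) (f : S → ℝ), ∑ s ∈ J,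
        (if h : s ∈ J then q ⟨s, h⟩ else 0) * f s = ∑ s : J, q s * f s := by
      intro q f
      rw [← Finset.sum_coe_sort]
      exact Finset.sum_congr rfl fun s _ => by rw [dif_pos s.2]
    have h3 := h2 J x (fun s => if h : s ∈ J then y x ⟨s, h⟩ else 0) (hT x hx).1
      (fun i => by rw [hext]; exact hy x hx i) v
      (fun s => if h : s ∈ J then u ⟨s, h⟩ else 0) (fun s hs => dif_neg hs)
      (fun s hs => by
        have h4 := hv ⟨s, hs⟩
        simp only [sub_eq_add_neg (tilt _ _), ← C_neg, polyDeriv_add_C] at h4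
        exact h4)
      (fun i => by
        rw [Finset.sum_add_distrib, hext, hext, ← Finset.sum_add_distrib]
        exact hvu i)
    refine Prod.ext h3.1 (funext fun s => ?_)
    have := congrFun h3.2 s
    rwa [dif_pos s.2] at this

end Generic

section ActiveSets

open MeasureTheory Filter

variable {k r : ℕ}

@[fun_prop]
lemma continuous_eval_tilt {α : Type*} [TopologicalSpace α] (p : MvPolynomial (Fin k) ℝ)
    {f a : α → Fin k → ℝ} (hf : Continuous f) (ha : Continuous a) :
    Continuous fun z => eval (f z) (tilt p (a z)) := by
  simp only [eval_tilt]
  have := (continuous_eval' p).comp hf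
  exact this.add (by fun_prop)

lemma eventually_exists_solution (V : Fin r → MvPolynomial (Fin k) ℝ) (q : Fin k → ℝ)
    (hsurj : Function.Surjective fun v l => polyDeriv (V l) q v) {O : Set (Fin k → ℝ)}
    (hO : O ∈ nhds q) :
    ∀ᶠ y : (Fin r → Fin k → ℝ) × (Fin r → ℝ) in nhds (0, fun l => eval q (V l)),
      ∃ x ∈ O, ∀ l, eval x (tilt (V l) (y.1 l)) = y.2 l := by
  let F : (Fin k → ℝ) × (Fin r → Fin k → ℝ) → (Fin r → Fin k → ℝ) × (Fin r → ℝ) := fun z =>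
    (z.2, fun l => eval z.1 (V l) + ∑ i, z.2 l i * z.1 i)
  have hF : ContDiff ℝ 1 F := by
    refine ContDiff.prodMk contDiff_snd (contDiff_pi.2 fun l => ?_)
    exact ((contDiff_eval (V l)).comp contDiff_fst).add (by fun_prop)
  have hd := (hF.contDiffAt (x := (q, 0))).hasStrictFDerivAt one_ne_zero
  have hrange : (fderiv ℝ F (q, 0)).range = ⊤ := by
    refine LinearMap.range_eq_top.2 fun y => ?_
    obtain ⟨b, w⟩ := y
    obtain ⟨v, hv⟩ := hsurj fun l => w l - ∑ i, b l i * q i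
    refine ⟨(v, b), ?_⟩
    have h1 := hd.hasFDerivAt.hasLineDerivAt (v, b)
    have h2 : HasLineDerivAt ℝ F (b, w) (q, 0) (v, b) := by
      unfold HasLineDerivAt
      refine HasDerivAt.prodMk ?_ (hasDerivAt_pi.2 fun l => ?_)
      · simpa using (hasDerivAt_id (0 : ℝ)).smul_const b
      · simp only [Prod.fst_add, Prod.snd_add, Prod.smul_fst, Prod.smul_snd,
          Pi.add_apply, Pi.smul_apply, smul_eq_mul, Pi.zero_apply, zero_add]
        have h3 := hasDerivAt_eval_line (V l) q v
        have h4 : HasDerivAt (fun t : ℝ => ∑ i, t * b l i * (q i + t * v i))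
            (∑ i, b l i * q i) 0 := by
          refine HasDerivAt.fun_sum fun i _ => ?_
          have h5 := ((hasDerivAt_id (0 : ℝ)).mul_const (b l i)).fun_mul
            (((hasDerivAt_id (0 : ℝ)).mul_const (v i)).const_add (q i))
          simpa using h5
        refine (h3.fun_add h4).congr_deriv ?_
        have := congrFun hv l
        simp only at this
        rw [this]
        ring
    exact h1.unique h2
  have hmap := hd.map_nhds_eq_of_surj hrange
  have hval : F (q, 0) = (0, fun l => eval q (V l)) := by simp [F]
  rw [hval] at hmap
  rw [← hmap, eventually_map]
  filter_upwards [prod_mem_nhds hO univ_mem] with z hz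
  exact ⟨z.1, hz.1, fun l => by simp [F, eval_tilt]⟩

variable {ι At : Type*} [Fintype At] [DecidableEq At]

/-- Perturbing to a generic situation, each point `q i` produces a constrained minimizer whose set
of active constraints is counted with a Bézout bound. -/
theorem exists_active_sets [Fintype ι] (Φ : MvPolynomial (Fin k) ℝ)
    (V : Fin r → MvPolynomial (Fin k) ℝ)
    (g : At → MvPolynomial (Fin k) ℝ) (τ s : At → ℝ) (Rel : ι → Finset At)
    {B : Set (Fin k → ℝ)} (hB : IsCompact B) (N : ι → Set (Fin k → ℝ)) (hN : ∀ i, IsOpen (N i))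
    (hNd : ∀ i j, i ≠ j → Disjoint (N i) (N j)) {κ θ : ℝ} (hκ : 0 < κ)
    (hs : ∀ α, |s α| ≤ 1)
    (hcover : ∀ i, ∀ x ∈ B, eval x Φ ≤ θ + κ →
      (∀ α ∈ Rel i, -κ ≤ s α * (eval x (g α) - τ α)) → x ∈ interior B ∧ x ∈ ⋃ j, N j)
    (q : ι → Fin k → ℝ) (hqN : ∀ i, q i ∈ N i) (hqB : ∀ i, q i ∈ interior B)
    (hqθ : ∀ i, eval (q i) Φ < θ)
    (hqs : ∀ i, ∀ α ∈ Rel i, 0 < s α * (eval (q i) (g α) - τ α))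
    (β : Fin r → ℝ) (hqβ : ∀ i l, eval (q i) (V l) = β l)
    (hsurj : ∀ i, Function.Surjective fun v l => polyDeriv (V l) (q i) v) :
    ∃ A : ι → Finset At, (∀ i, A i ⊆ Rel i ∧ ∃ x ∈ B, ∀ α ∈ A i, |eval x (g α) - τ α| ≤ κ) ∧
      ∀ (A₀ : Finset At) (d : At → ℕ) (dV e : ℕ),
        (∀ α ∈ A₀, (g α).totalDegree ≤ d α ∧ 1 ≤ d α ∧ (g α).totalDegree - 1 ≤ e) →
        (∀ l, (V l).totalDegree ≤ dV ∧ 1 ≤ dV ∧ (V l).totalDegree - 1 ≤ e) →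
        Φ.totalDegree - 1 ≤ e →
        (Finset.univ.filter fun i => A i = A₀).card ≤
          dV ^ r * (∏ α ∈ A₀, d α) * (k.choose (r + A₀.card) * e ^ (k - (r + A₀.card))) := by
  classical
  let G : Fin r ⊕ At → MvPolynomial (Fin k) ℝ := Sum.elim V g
  let π₀ : Params k (Fin r ⊕ At) := (0, Sum.elim β τ, 0)
  have hclose : ∀ᶠ π : Params k (Fin r ⊕ At) in nhds π₀, ∀ x ∈ B,
      |eval x (tilt Φ (-π.2.2)) - eval x Φ| < κ ∧
      ∀ α, |(eval x (tilt (g α) (π.1 (Sum.inr α))) - π.2.1 (Sum.inr α)) -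
        (eval x (g α) - τ α)| < κ := by
    refine hB.eventually_forall_of_forall_eventually fun x _ => ?_
    refine Eventually.and ?_ (eventually_all.2 fun α => ?_)
    · have hc : Continuous fun z : Params k (Fin r ⊕ At) × (Fin k → ℝ) =>
          |eval z.2 (tilt Φ (-z.1.2.2)) - eval z.2 Φ| :=
        ((continuous_eval_tilt Φ (by fun_prop) (by fun_prop)).sub
          ((continuous_eval' Φ).comp continuous_snd)).abs
      exact hc.continuousAt.eventually_lt continuousAt_const (by simpa [π₀, eval_tilt] using hκ)
    · have hc : Continuous fun z : Params k (Fin r ⊕ At) × (Fin k → ℝ) =>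
          |(eval z.2 (tilt (g α) (z.1.1 (Sum.inr α))) - z.1.2.1 (Sum.inr α)) -
            (eval z.2 (g α) - τ α)| :=
        (((continuous_eval_tilt (g α) (by fun_prop) (by fun_prop)).sub (by fun_prop)).sub
          (((continuous_eval' (g α)).comp continuous_snd).sub continuous_const)).abs
      exact hc.continuousAt.eventually_lt continuousAt_const (by simpa [π₀, eval_tilt] using hκ)
  have hfeas : ∀ᶠ π : Params k (Fin r ⊕ At) in nhds π₀, ∀ i, ∃ x,
      (∀ l, eval x (tilt (V l) (π.1 (Sum.inl l))) = π.2.1 (Sum.inl l)) ∧ x ∈ N i ∧ x ∈ B ∧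
      eval x (tilt Φ (-π.2.2)) < θ ∧ ∀ α ∈ Rel i,
        0 < s α * (eval x (tilt (g α) (π.1 (Sum.inr α))) - π.2.1 (Sum.inr α)) := by
    refine eventually_all.2 fun i => ?_
    have hopen : ∀ᶠ z : (Fin k → ℝ) × Params k (Fin r ⊕ At) in nhds (q i) ×ˢ nhds π₀,
        z.1 ∈ N i ∧ z.1 ∈ B ∧ eval z.1 (tilt Φ (-z.2.2.2)) < θ ∧ ∀ α ∈ Rel i,
        0 < s α * (eval z.1 (tilt (g α) (z.2.1 (Sum.inr α))) - z.2.2.1 (Sum.inr α)) := by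
      rw [← nhds_prod_eq]
      refine Eventually.and ?_ (Eventually.and ?_ (Eventually.and ?_ ?_))
      · exact continuousAt_fst.eventually ((hN i).mem_nhds (hqN i))
      · exact continuousAt_fst.eventually (mem_interior_iff_mem_nhds.1 (hqB i))
      · have hc : Continuous fun z : (Fin k → ℝ) × Params k (Fin r ⊕ At) =>
          eval z.1 (tilt Φ (-z.2.2.2)) := continuous_eval_tilt Φ (by fun_prop) (by fun_prop)
        exact hc.continuousAt.eventually_lt continuousAt_const
          (by simpa [π₀, eval_tilt] using hqθ i)
      · rw [Filter.eventually_all_finset]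
        intro α hα
        have hc : Continuous fun z : (Fin k → ℝ) × Params k (Fin r ⊕ At) =>
            s α * (eval z.1 (tilt (g α) (z.2.1 (Sum.inr α))) - z.2.2.1 (Sum.inr α)) :=
          continuous_const.mul ((continuous_eval_tilt (g α) (by fun_prop) (by fun_prop)).sub
            (by fun_prop))
        exact continuousAt_const.eventually_lt hc.continuousAt
          (by simpa [π₀, eval_tilt] using hqs i α hα)
    obtain ⟨pa, hpa, pb, hpb, hab⟩ := eventually_prod_iff.1 hopen
    have hsol := eventually_exists_solution V (q i) (hsurj i) hpa
    have hres : Continuous fun π : Params k (Fin r ⊕ At) =>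
      ((fun l => π.1 (Sum.inl l), fun l => π.2.1 (Sum.inl l)) :
        (Fin r → Fin k → ℝ) × (Fin r → ℝ)) := by fun_prop
    have hres₀ : ((fun l => π₀.1 (Sum.inl l), fun l => π₀.2.1 (Sum.inl l)) :
        (Fin r → Fin k → ℝ) × (Fin r → ℝ)) = (0, fun l => eval (q i) (V l)) :=
      Prod.ext rfl (funext fun l => (hqβ i l).symm)
    rw [← hres₀] at hsol
    filter_upwards [hres.continuousAt.eventually hsol, hpb] with π hπ hb
    obtain ⟨x, hx, hxe⟩ := hπ
    exact ⟨x, hxe, hab hx hb⟩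
  obtain ⟨π, hcount, hcl, hfe⟩ := (Measure.dense_of_ae (ae_card_extr_le G Φ)).inter_nhds_nonempty
    (hclose.and hfeas)
  have hmin : ∀ i, ∃ x, ((∀ l, eval x (tilt (V l) (π.1 (Sum.inl l))) = π.2.1 (Sum.inl l)) ∧
      x ∈ N i ∧ x ∈ interior B ∧ ∀ α ∈ Rel i,
        0 ≤ s α * (eval x (tilt (g α) (π.1 (Sum.inr α))) - π.2.1 (Sum.inr α))) ∧
      ∀ z, (∀ l, eval z (tilt (V l) (π.1 (Sum.inl l))) = π.2.1 (Sum.inl l)) → z ∈ N i → z ∈ B →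
        (∀ α ∈ Rel i, 0 ≤ s α * (eval z (tilt (g α) (π.1 (Sum.inr α))) - π.2.1 (Sum.inr α))) →
        eval x (tilt Φ (-π.2.2)) ≤ eval z (tilt Φ (-π.2.2)) := by
    intro i
    let D : Set (Fin k → ℝ) := {x | (∀ l, eval x (tilt (V l) (π.1 (Sum.inl l))) =
      π.2.1 (Sum.inl l)) ∧ eval x (tilt Φ (-π.2.2)) ≤ θ ∧ ∀ α ∈ Rel i,
        0 ≤ s α * (eval x (tilt (g α) (π.1 (Sum.inr α))) - π.2.1 (Sum.inr α))}
    have hDc : IsClosed D := by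
      simp only [D, Set.ofPred_and, Set.ofPred_forall]
      refine IsClosed.inter (isClosed_iInter fun l => isClosed_eq (continuous_eval' _)
        continuous_const) (IsClosed.inter (isClosed_le (continuous_eval' _) continuous_const)
        (isClosed_biInter fun α _ => isClosed_le continuous_const
          (continuous_const.mul ((continuous_eval' _).sub continuous_const))))
    have hDB : ∀ x ∈ B, x ∈ D → x ∈ interior B ∧ x ∈ ⋃ j, N j := by
      intro x hx hxD
      obtain ⟨h1, h2⟩ := hcl x hx
      refine hcover i x hx ?_ fun α hα => ?_
      · have := (abs_lt.1 h1).1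
        linarith [hxD.2.1]
      · have h3 := hxD.2.2 α hα
        have h4 : |s α * ((eval x (tilt (g α) (π.1 (Sum.inr α))) - π.2.1 (Sum.inr α)) -
            (eval x (g α) - τ α))| ≤ κ := by
          rw [abs_mul]
          calc _ ≤ 1 * κ := mul_le_mul (hs α) (h2 α).le (abs_nonneg _) zero_le_one
            _ = κ := one_mul κ
        rw [mul_sub] at h4
        linarith [(abs_le.1 h4).2]
    have hE : B ∩ D ∩ N i = B ∩ D ∩ (⋃ j ∈ {j | j ≠ i}, N j)ᶜ := by
      ext x
      simp only [Set.mem_inter_iff, Set.mem_compl_iff, Set.mem_iUnion, Set.mem_ofPred_eq]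
      refine and_congr_right fun hx => ⟨fun hxi ⟨j, hj, hxj⟩ => ?_, fun h => ?_⟩
      · exact Set.disjoint_left.1 (hNd j i hj) hxj hxi
      · obtain ⟨j, hj⟩ := Set.mem_iUnion.1 (hDB x hx.1 hx.2).2
        by_cases hji : j = i
        · exact hji ▸ hj
        · exact absurd ⟨j, hji, hj⟩ h
    have hEc : IsCompact (B ∩ D ∩ N i) := by
      rw [hE]
      exact (hB.inter_right hDc).inter_right
        (isOpen_biUnion fun j _ => hN j).isClosed_compl
    obtain ⟨x₀, hx₀e, hx₀N, hx₀B, hx₀θ, hx₀s⟩ := hfe i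
    have hx₀ : x₀ ∈ B ∩ D ∩ N i := ⟨⟨hx₀B, hx₀e, hx₀θ.le, fun α hα => (hx₀s α hα).le⟩, hx₀N⟩
    obtain ⟨x, hx, hxmin⟩ := hEc.exists_isMinOn ⟨x₀, hx₀⟩
      (continuous_eval' (tilt Φ (-π.2.2))).continuousOn
    refine ⟨x, ⟨hx.1.2.1, hx.2, (hDB x hx.1.1 hx.1.2).1, hx.1.2.2.2⟩, fun z hze hzN hzB hzs => ?_⟩
    rcases le_total (eval z (tilt Φ (-π.2.2))) θ with h | h
    · exact hxmin ⟨⟨hzB, hze, h, hzs⟩, hzN⟩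
    · exact hx.1.2.2.1.trans h
  choose x hx hxmin using hmin
  have hxinj : Function.Injective x := fun i j hij => by
    by_contra hne
    exact Set.disjoint_left.1 (hNd i j hne) (hx i).2.1 (hij ▸ (hx j).2.1)
  refine ⟨fun i => (Rel i).filter fun α =>
    eval (x i) (tilt (g α) (π.1 (Sum.inr α))) = π.2.1 (Sum.inr α), fun i =>
    ⟨Finset.filter_subset _ _, x i, interior_subset (hx i).2.2.1, fun α hα => ?_⟩,
    fun A₀ d dV e hd hdV he => ?_⟩
  · have h1 := (hcl (x i) (interior_subset (hx i).2.2.1)).2 α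
    rw [(Finset.mem_filter.1 hα).2, sub_self, zero_sub, abs_neg] at h1
    exact h1.le
  · have hc := hcount (Finset.univ.disjSum A₀) (Sum.elim (fun _ => dV) d) e ?_ he
      ((Finset.univ.filter fun i => ((Rel i).filter fun α =>
        eval (x i) (tilt (g α) (π.1 (Sum.inr α))) = π.2.1 (Sum.inr α)) = A₀).image x) ?_
    · rw [Finset.card_image_of_injective _ hxinj, Finset.prod_disjSum, Finset.card_disjSum] at hc
      simpa using hc
    · rintro (l | α) hα
      · exact hdV l
      · exact hd α (Finset.inr_mem_disjSum.1 hα)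
    · intro z hz
      obtain ⟨i, hi, rfl⟩ := Finset.mem_image.1 hz
      have hA := (Finset.mem_filter.1 hi).2
      refine ⟨?_, Or.inl ?_⟩
      · rintro (l | α) hα
        · exact (hx i).1 l
        · rw [Finset.inr_mem_disjSum, ← hA] at hα
          exact (Finset.mem_filter.1 hα).2
      · have hev : ∀ᶠ z in nhds (x i), z ∈ N i ∧ z ∈ B ∧ ∀ α ∈ Rel i, α ∉ A₀ →
            0 < s α * (eval z (tilt (g α) (π.1 (Sum.inr α))) - π.2.1 (Sum.inr α)) := by
          refine Eventually.and ((hN i).mem_nhds (hx i).2.1)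
            (Eventually.and (mem_interior_iff_mem_nhds.1 (hx i).2.2.1) ?_)
          rw [Filter.eventually_all_finset]
          intro α hα
          by_cases hA₀ : α ∈ A₀
          · simp [hA₀]
          have hpos : 0 < s α * (eval (x i) (tilt (g α) (π.1 (Sum.inr α))) -
              π.2.1 (Sum.inr α)) := by
            refine lt_of_le_of_ne ((hx i).2.2.2 α hα) fun h0 => ?_
            rcases mul_eq_zero.1 h0.symm with h | h
            · have := hqs i α hα
              simp [h] at this
            · exact hA₀ (hA ▸ Finset.mem_filter.2 ⟨hα, sub_eq_zero.1 h⟩)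
          have hcont : Continuous fun z => s α * (eval z (tilt (g α) (π.1 (Sum.inr α))) -
              π.2.1 (Sum.inr α)) := continuous_const.mul ((continuous_eval' _).sub continuous_const)
          filter_upwards [continuousAt_const.eventually_lt hcont.continuousAt hpos] with z hz _
          exact hz
        filter_upwards [hev.filter_mono nhdsWithin_le_nhds, self_mem_nhdsWithin] with z hz hze
        refine hxmin i z (fun l => hze (Sum.inl l) (Finset.inl_mem_disjSum.2 (Finset.mem_univ l)))
          hz.1 hz.2.1 fun α hα => ?_
        by_cases hA₀ : α ∈ A₀
        · rw [show eval z (tilt (g α) (π.1 (Sum.inr α))) = π.2.1 (Sum.inr α) from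
            hze (Sum.inr α) (Finset.inr_mem_disjSum.2 hA₀), sub_self, mul_zero]
        · exact (hz.2.2 α hα hA₀).le

end ActiveSets

section Directions

open MeasureTheory

lemma measure_image_eq_zero_of_dimH_lt {E F : Type*} [NormedAddCommGroup E] [NormedSpace ℝ E]
    [FiniteDimensional ℝ E] [NormedAddCommGroup F] [NormedSpace ℝ F] [FiniteDimensional ℝ F]
    [MeasurableSpace F] [BorelSpace F] (μ : Measure F) [μ.IsAddHaarMeasure] {f : E → F} {s : Set E}
    (hf : ∀ x ∈ s, ContDiffAt ℝ 1 f x) (hs : dimH s < Module.finrank ℝ F) : μ (f '' s) = 0 := by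
  have := isAddHaarMeasure_hausdorffMeasure (E := F)
  have hle : dimH (f '' s) ≤ dimH s := by
    refine dimH_image_le_of_locally_lipschitzOn fun x hx => ?_
    obtain ⟨C, t, ht, hC⟩ := (hf x hx).exists_lipschitzOnWith
    exact ⟨C, t, mem_nhdsWithin_of_mem_nhds ht, hC⟩
  refine measure_zero_of_dimH_lt (d := (Module.finrank ℝ F : NNReal)) ?_
    (hle.trans_lt (by simpa using hs))
  rw [NNReal.coe_natCast]
  exact Measure.absolutelyContinuous_isAddHaarMeasure _ _

variable {k k' r : ℕ}

/-- A set of dimension at most `k'` avoids almost all small spheres in suitable affine spaces of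
codimension `k'` through finitely many given points. -/
theorem exists_directions (hr : r + k' = k) {Z : Set (Fin k → ℝ)} (hZ : dimH Z ≤ (k' : ℝ≥0∞))
    {F : Set (Fin k → ℝ)} (hF : F.Finite) :
    ∃ u : Fin r → Fin k → ℝ, ∀ p ∈ F, ∀ᵐ ρ : ℝ, 0 < ρ → ∀ t : Fin r → ℝ, ∑ l, t l ^ 2 = ρ →
      p + ∑ l, t l • u l ∉ Z := by
  subst hr
  let e : Fin r ⊕ Fin k' ≃ Fin (r + k') := finSumFinEquiv
  have key : ∀ s : Finset (Fin r), ∃ B : Fin r → Fin k' → ℝ, ∀ p ∈ F, ∀ᵐ ρ : ℝ, 0 < ρ → ∀ w ∈ Z,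
      (∀ j, w (e (Sum.inr j)) = p (e (Sum.inr j)) +
        ∑ l ∈ s, (w (e (Sum.inl l)) - p (e (Sum.inl l))) * B l j) →
      ∑ l ∈ s, (w (e (Sum.inl l)) - p (e (Sum.inl l))) ^ 2 ≠ ρ := by
    intro s
    induction s using Finset.induction_on with
    | empty => exact ⟨0, fun p _ => Filter.Eventually.of_forall fun ρ hρ w _ _ h =>
        hρ.ne (by simpa using h)⟩
    | insert l₀ s hl₀ ih =>
      obtain ⟨B, hB⟩ := ih
      let f : (Fin (r + k') → ℝ) → (Fin (r + k') → ℝ) → (Fin k' → ℝ) × ℝ := fun p w =>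
        (fun j => (w (e (Sum.inr j)) - p (e (Sum.inr j)) -
          ∑ l ∈ s, (w (e (Sum.inl l)) - p (e (Sum.inl l))) * B l j) *
            (w (e (Sum.inl l₀)) - p (e (Sum.inl l₀)))⁻¹,
          ∑ l ∈ insert l₀ s, (w (e (Sum.inl l)) - p (e (Sum.inl l))) ^ 2)
      have : (volume : Measure ((Fin k' → ℝ) × ℝ)).IsAddHaarMeasure :=
        Measure.prod.instIsAddHaarMeasure _ _
      have hnull : ∀ p, (volume : Measure ((Fin k' → ℝ) × ℝ))
          (f p '' {w ∈ Z | w (e (Sum.inl l₀)) - p (e (Sum.inl l₀)) ≠ 0}) = 0 := by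
        intro p
        refine measure_image_eq_zero_of_dimH_lt _ (fun w hw => ?_) ?_
        · refine ContDiffAt.prodMk (contDiffAt_pi.2 fun j => ?_) (by fun_prop)
          exact ContDiffAt.mul (by fun_prop) (ContDiffAt.inv (by fun_prop) hw.2)
        · refine (dimH_mono (Set.sep_subset _ _)).trans_lt (hZ.trans_lt ?_)
          simp only [Module.finrank_prod, Module.finrank_fin_fun, Module.finrank_self]
          exact_mod_cast Nat.lt_succ_self k'
      have hae : ∀ᵐ b : Fin k' → ℝ, ∀ p ∈ F, ∀ᵐ ρ : ℝ,
          (b, ρ) ∉ f p '' {w ∈ Z | w (e (Sum.inl l₀)) - p (e (Sum.inl l₀)) ≠ 0} :=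
        (ae_ball_iff hF.countable).2 fun p _ =>
          Measure.ae_ae_of_ae_prod (measure_eq_zero_iff_ae_notMem.1 (hnull p))
      obtain ⟨b, hb⟩ := hae.exists
      refine ⟨Function.update B l₀ b, fun p hp => ?_⟩
      filter_upwards [hB p hp, hb p hp] with ρ h1 h2 hρ w hw hwb hsum
      have hupd : ∀ j, ∑ l ∈ s, (w (e (Sum.inl l)) - p (e (Sum.inl l))) *
          Function.update B l₀ b l j =
          ∑ l ∈ s, (w (e (Sum.inl l)) - p (e (Sum.inl l))) * B l j := fun j =>
        Finset.sum_congr rfl fun l hl => by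
          rw [Function.update_of_ne (ne_of_mem_of_not_mem hl hl₀)]
      simp only [Finset.sum_insert hl₀, hupd, Function.update_self] at hwb
      by_cases h0 : w (e (Sum.inl l₀)) - p (e (Sum.inl l₀)) = 0
      · refine h1 hρ w hw (fun j => ?_) ?_
        · rw [hwb j, h0]
          ring
        · rw [← hsum, Finset.sum_insert hl₀, h0]
          ring
      · refine h2 ⟨w, ⟨hw, h0⟩, Prod.ext (funext fun j => ?_) hsum⟩
        simp only [f]
        rw [hwb j, ← div_eq_mul_inv, div_eq_iff h0]
        ring
  obtain ⟨B, hB⟩ := key Finset.univ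
  refine ⟨fun l i => Sum.elim (Pi.single l 1) (B l) (e.symm i), fun p hp => ?_⟩
  filter_upwards [hB p hp] with ρ h hρ t ht hmem
  have hl : ∀ l, (p + ∑ l, t l • fun i => Sum.elim (Pi.single l (1 : ℝ)) (B l) (e.symm i))
      (e (Sum.inl l)) - p (e (Sum.inl l)) = t l := fun l => by
    simp [Finset.sum_apply, Pi.single_apply]
  refine h hρ _ hmem (fun j => ?_) ?_
  · simp only [hl]
    simp [Finset.sum_apply]
  · simpa only [hl] using ht

end Directions

section Separation

/-- Points in different connected components of a compact set can be separated by disjoint open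
sets covering it. -/
theorem exists_open_separation {E ι : Type*} [MetricSpace E] [Finite ι] [Nonempty ι] {K : Set E}
    (hK : IsCompact K) (p : ι → E) (hp : ∀ i, p i ∈ K)
    (hsep : ∀ i j, i ≠ j → p j ∉ connectedComponentIn K (p i)) :
    ∃ N : ι → Set E, (∀ i, IsOpen (N i)) ∧ (∀ i j, i ≠ j → Disjoint (N i) (N j)) ∧
      (∀ i, p i ∈ N i) ∧ K ⊆ ⋃ i, N i := by
  classical
  have := isCompact_iff_compactSpace.1 hK
  have hW : ∀ i j, ∃ W : Set K, IsClopen W ∧ (i ≠ j → ⟨p i, hp i⟩ ∈ W ∧ ⟨p j, hp j⟩ ∉ W) := by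
    intro i j
    by_cases hij : i = j
    · exact ⟨∅, isClopen_empty, fun h => absurd hij h⟩
    have h1 : (⟨p j, hp j⟩ : K) ∉ connectedComponent (⟨p i, hp i⟩ : K) := fun h =>
      hsep i j hij (by
        rw [connectedComponentIn_eq_image (hp i)]
        exact ⟨_, h, rfl⟩)
    rw [connectedComponent_eq_iInter_isClopen, Set.mem_iInter] at h1
    push Not at h1
    obtain ⟨⟨W, hW, hiW⟩, hjW⟩ := h1
    exact ⟨W, hW, fun _ => ⟨hiW, hjW⟩⟩
  choose W hWc hW using hW
  let G : K → ι × ι → Prop := fun x ij => x ∈ W ij.1 ij.2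
  have hG : IsLocallyConstant G := by
    refine (IsLocallyConstant.iff_eventually_eq G).2 fun x => ?_
    have : ∀ ij : ι × ι, ∀ᶠ y in nhds x, (y ∈ W ij.1 ij.2 ↔ x ∈ W ij.1 ij.2) := by
      intro ij
      by_cases hx : x ∈ W ij.1 ij.2
      · filter_upwards [(hWc ij.1 ij.2).isOpen.mem_nhds hx] with y hy
        exact iff_of_true hy hx
      · filter_upwards [(hWc ij.1 ij.2).compl.isOpen.mem_nhds hx] with y hy
        exact iff_of_false hy hx
    filter_upwards [Filter.eventually_all.2 this] with y hy
    exact funext fun ij => propext (hy ij)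
  let h : ι → (ι × ι → Prop) := fun i => G ⟨p i, hp i⟩
  have hinj : Function.Injective h := fun i j hij => by
    by_contra hne
    have := congrFun hij (i, j)
    simp only [h, G, eq_iff_iff] at this
    exact (hW i j hne).2 (this.1 (hW i j hne).1)
  obtain ⟨c, hc⟩ := Finite.exists_equiv_fin ι
  obtain ⟨c⟩ := hc
  have hcont : Continuous fun x : K => ((c (Function.invFun h (G x)) : ℕ) : ℝ) :=
    (hG.comp fun y => ((c (Function.invFun h y) : ℕ) : ℝ)).continuous
  obtain ⟨f, hf⟩ := ContinuousMap.exists_restrict_eq hK.isClosed ⟨_, hcont⟩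
  have hfx : ∀ x (hx : x ∈ K), f x = ((c (Function.invFun h (G ⟨x, hx⟩)) : ℕ) : ℝ) :=
    fun x hx => congrArg (fun f : C(K, ℝ) => f ⟨x, hx⟩) hf
  refine ⟨fun i => f ⁻¹' Metric.ball ((c i : ℕ) : ℝ) (1 / 2), fun i =>
    Metric.isOpen_ball.preimage f.continuous, fun i j hij => ?_, fun i => ?_, fun x hx => ?_⟩
  · refine Disjoint.preimage _ (Metric.ball_disjoint_ball ?_)
    rw [add_halves, Nat.dist_cast_real]
    exact Nat.pairwise_one_le_dist fun h => hij (c.injective (Fin.ext h))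
  · simp [hfx _ (hp i), show G ⟨p i, hp i⟩ = h i from rfl, Function.leftInverse_invFun hinj i]
  · exact Set.mem_iUnion.2 ⟨Function.invFun h (G ⟨x, hx⟩), by simp [hfx x hx]⟩

end Separation

section Fibers

open MeasureTheory Filter

variable {k k' r : ℕ}

/-- The directional derivative of a polynomial. -/
noncomputable def dirDeriv (u : Fin k → ℝ) (p : MvPolynomial (Fin k) ℝ) : MvPolynomial (Fin k) ℝ :=
  ∑ i, C (u i) * pderiv i p

lemma eval_dirDeriv (u x : Fin k → ℝ) (p : MvPolynomial (Fin k) ℝ) :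
    eval x (dirDeriv u p) = polyDeriv p x u := by
  simp [dirDeriv, polyDeriv_apply, mul_comm]

lemma totalDegree_dirDeriv_le (u : Fin k → ℝ) (p : MvPolynomial (Fin k) ℝ) :
    (dirDeriv u p).totalDegree ≤ p.totalDegree - 1 := by
  refine totalDegree_finsetSum_le fun i _ => (totalDegree_mul _ _).trans ?_
  simpa using totalDegree_pderiv_le p i

variable (k) in
/-- The squared Euclidean norm as a polynomial. -/
noncomputable def sqNorm : MvPolynomial (Fin k) ℝ := ∑ i, X i ^ 2

lemma eval_sqNorm (x : Fin k → ℝ) : eval x (sqNorm k) = ∑ i, x i ^ 2 := by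
  simp [sqNorm]

lemma eval_sqNorm_nonneg (x : Fin k → ℝ) : 0 ≤ eval x (sqNorm k) := by
  rw [eval_sqNorm]
  positivity

lemma isCompact_sum_sq_le (M : ℝ) : IsCompact {t : Fin r → ℝ | ∑ l, t l ^ 2 ≤ M} := by
  refine Metric.isCompact_of_isClosed_isBounded (isClosed_le (by fun_prop) continuous_const) ?_
  refine (Metric.isBounded_closedBall (x := (0 : Fin r → ℝ)) (r := √M)).subset fun t ht => ?_
  rw [mem_closedBall_zero_iff, pi_norm_le_iff_of_nonneg (Real.sqrt_nonneg _)]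
  intro l
  refine Real.abs_le_sqrt (le_trans ?_ ht)
  exact Finset.single_le_sum (f := fun l => t l ^ 2) (fun l _ => sq_nonneg _) (Finset.mem_univ l)

lemma exists_small_sphere {Z : Set (Fin k → ℝ)} {u : Fin r → Fin k → ℝ} {p : Fin k → ℝ}
    (hu : ∀ᵐ ρ : ℝ, 0 < ρ → ∀ t : Fin r → ℝ, ∑ l, t l ^ 2 = ρ → p + ∑ l, t l • u l ∉ Z)
    {U : Set (Fin k → ℝ)} (hU : U ∈ nhds p) :
    ∃ ρ > 0, (∀ t : Fin r → ℝ, ∑ l, t l ^ 2 ≤ ρ → p + ∑ l, t l • u l ∈ U) ∧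
      ∀ t : Fin r → ℝ, ∑ l, t l ^ 2 = ρ → p + ∑ l, t l • u l ∉ Z := by
  have hc : Continuous fun t : Fin r → ℝ => p + ∑ l, t l • u l := by fun_prop
  have h0 : p + ∑ l, (0 : Fin r → ℝ) l • u l = p := by simp
  have hmem : (fun t : Fin r → ℝ => p + ∑ l, t l • u l) ⁻¹' U ∈ nhds 0 :=
    hc.continuousAt.preimage_mem_nhds (by rwa [h0])
  obtain ⟨ε, hε, hball⟩ := Metric.mem_nhds_iff.1 hmem
  obtain ⟨ρ, hρ, hρ0, hρε⟩ := (Measure.dense_of_ae hu).exists_between (show 0 < ε ^ 2 by positivity)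
  refine ⟨ρ, hρ0, fun t ht => hball ?_, hρ hρ0⟩
  rw [mem_ball_zero_iff, pi_norm_lt_iff hε]
  intro l
  refine abs_lt_of_sq_lt_sq (lt_of_le_of_lt ?_ hρε) hε.le
  exact (Finset.single_le_sum (f := fun l => t l ^ 2) (fun l _ => sq_nonneg _)
    (Finset.mem_univ l)).trans ht

theorem exists_fiber_points {ι : Type*} [Finite ι] (Q : MvPolynomial (Fin k) ℝ)
    (hQ : ∀ x, 0 ≤ eval x Q) (hr : r + k' = k) (hdim : dimH {x | eval x Q = 0} ≤ (k' : ℝ≥0∞))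
    (p : ι → Fin k → ℝ) (hp : ∀ i, eval (p i) Q = 0) (U : ι → Set (Fin k → ℝ))
    (hU : ∀ i, U i ∈ nhds (p i)) {M η : ℝ} (hpM : ∀ i, eval (p i) (sqNorm k) < M)
    (hη : 0 < η) :
    ∃ u : Fin r → Fin k → ℝ, ∃ ε θ : ℝ, 0 < ε ∧ ε * M ≤ η ∧ θ < ε * M ∧
      ∃ (β : Fin r → ℝ) (q : ι → Fin k → ℝ), ∀ i, q i ∈ U i ∧
        eval (q i) (Q + C ε * sqNorm k) < θ ∧
        (∀ l, eval (q i) (dirDeriv (u l) (Q + C ε * sqNorm k)) = β l) ∧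
        Function.Surjective fun v l =>
          polyDeriv (dirDeriv (u l) (Q + C ε * sqNorm k)) (q i) v := by
  obtain ⟨u, hu⟩ := exists_directions hr hdim (Set.finite_range p)
  choose ρ hρ hρU hρZ using fun i => exists_small_sphere (hu (p i) ⟨i, rfl⟩) (hU i)
  let w : ι → (Fin r → ℝ) → Fin k → ℝ := fun i t => p i + ∑ l, t l • u l
  have hwd : ∀ i, Differentiable ℝ (w i) := fun i => by
    simp only [w]
    fun_prop
  have hwl : ∀ i t v (s : ℝ), w i (t + s • v) = w i t + s • ∑ l, v l • u l := by
    intro i t v s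
    simp only [w, Pi.add_apply, Pi.smul_apply, smul_eq_mul, add_smul, mul_smul,
      Finset.sum_add_distrib, Finset.smul_sum, add_assoc]
  have hm : ∀ i, ∃ m > 0, ∀ t : Fin r → ℝ, ∑ l, t l ^ 2 = ρ i → m ≤ eval (w i t) Q := by
    intro i
    have hS : IsCompact {t : Fin r → ℝ | ∑ l, t l ^ 2 = ρ i} :=
      (isCompact_sum_sq_le (ρ i)).of_isClosed_subset (isClosed_eq (by fun_prop) continuous_const)
        fun t ht => le_of_eq ht
    rcases Set.eq_empty_or_nonempty {t : Fin r → ℝ | ∑ l, t l ^ 2 = ρ i} with he | hne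
    · exact ⟨1, one_pos, fun t ht => (Set.eq_empty_iff_forall_notMem.1 he t ht).elim⟩
    · obtain ⟨t₀, ht₀, hmin⟩ := hS.exists_isMinOn hne
        ((continuous_eval' Q).comp (hwd i).continuous).continuousOn
      exact ⟨eval (w i t₀) Q, lt_of_le_of_ne (hQ _) fun h => hρZ i t₀ ht₀ h.symm,
        fun t ht => hmin ht⟩
  choose m hm0 hm using hm
  have hε : ∀ᶠ ε : ℝ in nhdsWithin 0 (Set.Ioi 0), 0 < ε ∧ ε * M < η ∧ ∀ i, ε * M < m i := by
    have hlim : Continuous fun ε : ℝ => ε * M := by fun_prop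
    refine Eventually.and self_mem_nhdsWithin (Eventually.filter_mono nhdsWithin_le_nhds
      (Eventually.and ?_ (eventually_all.2 fun i => ?_)))
    · exact hlim.continuousAt.eventually_lt continuousAt_const (by simpa using hη)
    · exact hlim.continuousAt.eventually_lt continuousAt_const (by simpa using hm0 i)
  obtain ⟨ε, hε0, hεη, hεm⟩ := hε.exists
  have hθ : ∀ᶠ θ : ℝ in nhdsWithin (ε * M) (Set.Iio (ε * M)), θ < ε * M ∧
      ∀ i, ε * eval (p i) (sqNorm k) < θ :=
    Eventually.and self_mem_nhdsWithin (Eventually.filter_mono nhdsWithin_le_nhds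
      (eventually_all.2 fun i => lt_mem_nhds (mul_lt_mul_of_pos_left (hpM i) hε0)))
  obtain ⟨θ, hθM, hθ⟩ := hθ.exists
  set Φ := Q + C ε * sqNorm k with hΦ
  have hΦe : ∀ x, eval x Φ = eval x Q + ε * eval x (sqNorm k) := fun x => by simp [hΦ]
  have hβ : ∀ᶠ β : Fin r → ℝ in nhds 0, ∀ i, ∀ t ∈ {t : Fin r → ℝ | ∑ l, t l ^ 2 ≤ ρ i},
      |∑ l, β l * t l| < m i - ε * M ∧ |∑ l, β l * t l| < θ - ε * eval (p i) (sqNorm k) := by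
    refine eventually_all.2 fun i => ?_
    refine (isCompact_sum_sq_le (ρ i)).eventually_forall_of_forall_eventually fun t _ => ?_
    have hc : Continuous fun z : (Fin r → ℝ) × (Fin r → ℝ) => |∑ l, z.1 l * z.2 l| := by fun_prop
    exact (hc.continuousAt.eventually_lt continuousAt_const
      (by simpa using hεm i)).and
      (hc.continuousAt.eventually_lt continuousAt_const (by simpa using hθ i))
  let γ : ι → (Fin r → ℝ) → Fin r → ℝ := fun i t l => eval (w i t) (dirDeriv (u l) Φ)
  have hγ : ∀ i, Differentiable ℝ (γ i) := fun i => differentiable_pi.2 fun l =>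
    differentiable_eval_comp _ (hwd i)
  have hreg : ∀ᵐ β : Fin r → ℝ, ∀ i, ∀ t, γ i t = β → Function.Injective (fderiv ℝ (γ i) t) :=
    ae_all_iff.2 fun i => ae_injective_fderiv volume (hγ i)
  obtain ⟨β, hβr, hβs⟩ := (Measure.dense_of_ae hreg).inter_nhds_nonempty hβ
  refine ⟨u, ε, θ, hε0, hεη.le, hθM, β, ?_⟩
  have hq : ∀ i, ∃ t : Fin r → ℝ, ∑ l, t l ^ 2 ≤ ρ i ∧ eval (w i t) Φ < θ ∧ γ i t = β := by
    intro i
    let φ : (Fin r → ℝ) → ℝ := fun t => eval (w i t) Φ - ∑ l, β l * t l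
    have hφ : Continuous φ := ((continuous_eval' Φ).comp (hwd i).continuous).sub (by fun_prop)
    have h0 : (0 : Fin r → ℝ) ∈ {t : Fin r → ℝ | ∑ l, t l ^ 2 ≤ ρ i} := by simpa using (hρ i).le
    obtain ⟨t, ht, hmin⟩ := (isCompact_sum_sq_le (ρ i)).exists_isMinOn ⟨0, h0⟩ hφ.continuousOn
    have hφ0 : φ t ≤ ε * eval (p i) (sqNorm k) := by
      have h1 : φ t ≤ φ 0 := hmin h0
      have h2 : φ 0 = ε * eval (p i) (sqNorm k) := by
        simp [φ, w, hΦe, hp]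
      exact h1.trans h2.le
    have hpε := mul_lt_mul_of_pos_left (hpM i) hε0
    have hlt : ∑ l, t l ^ 2 < ρ i := by
      refine lt_of_le_of_ne ht fun hS => ?_
      have h1 := hm i t hS
      have h2 := (abs_lt.1 (hβs i t ht).1).2
      have h3 : φ t = eval (w i t) Q + ε * eval (w i t) (sqNorm k) - ∑ l, β l * t l := by
        simp only [φ, hΦe]
      have h4 := mul_nonneg hε0.le (eval_sqNorm_nonneg (w i t))
      linarith
    have hloc : IsLocalMin φ t := by
      have hc : Continuous fun t : Fin r → ℝ => ∑ l, t l ^ 2 := by fun_prop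
      filter_upwards [hc.continuousAt.eventually_lt continuousAt_const hlt] with z hz
      exact hmin hz.le
    refine ⟨t, ht, ?_, funext fun l => ?_⟩
    · have h1 := (abs_lt.1 (hβs i t ht).2).2
      have h2 : φ t = eval (w i t) Φ - ∑ l, β l * t l := rfl
      linarith
    · have hd : HasLineDerivAt ℝ φ (polyDeriv Φ (w i t) (u l) - β l) t (Pi.single l 1) := by
        unfold HasLineDerivAt
        simp only [φ, hwl]
        refine HasDerivAt.fun_sub ?_ ?_
        · have : ∑ l', (Pi.single l (1 : ℝ) : Fin r → ℝ) l' • u l' = u l := by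
            simp [Pi.single_apply]
          rw [this]
          exact hasDerivAt_eval_line _ _ _
        · have h1 : ∀ s : ℝ, ∑ l', β l' * (t + s • (Pi.single l (1 : ℝ) : Fin r → ℝ)) l' =
              ∑ l', β l' * t l' + s * β l := by
            intro s
            simp [mul_add, Finset.sum_add_distrib, Pi.single_apply, mul_comm]
          simp only [h1]
          simpa using ((hasDerivAt_id (0 : ℝ)).mul_const (β l)).const_add (∑ l', β l' * t l')
      have := hloc.hasLineDerivAt_eq_zero hd
      simp only [γ, eval_dirDeriv]
      linarith
  choose t ht hθt hβt using hq
  refine ⟨fun i => w i (t i), fun i => ⟨hρU i _ (ht i), hθt i, congrFun (hβt i), fun c => ?_⟩⟩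
  have hsurj := (LinearMap.injective_iff_surjective (f := (fderiv ℝ (γ i) (t i)).toLinearMap)).1
    (hβr i _ (hβt i))
  obtain ⟨v, hv⟩ := hsurj c
  refine ⟨∑ l, v l • u l, ?_⟩
  have h1 := (hγ i (t i)).hasFDerivAt.hasLineDerivAt v
  have h2 : HasLineDerivAt ℝ (γ i) (fun l => polyDeriv (dirDeriv (u l) Φ) (w i (t i))
      (∑ l, v l • u l)) (t i) v := by
    unfold HasLineDerivAt
    simp only [γ, hwl]
    exact hasDerivAt_pi.2 fun l => hasDerivAt_eval_line _ _ _
  exact (h1.unique h2).symm.trans hv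

end Fibers

section Counting

lemma card_graphs_le {Y C : Type*} [DecidableEq Y] [DecidableEq C] [Fintype C] (I : Finset Y)
    (𝒜 : Finset (Finset (Y × C)))
    (h𝒜 : ∀ A ∈ 𝒜, Set.InjOn Prod.fst (A : Set (Y × C)) ∧ A.image Prod.fst = I) :
    𝒜.card ≤ Fintype.card C ^ I.card := by
  classical
  have hsub : 𝒜 ⊆ (Finset.univ : Finset (I → C)).image fun c =>
      Finset.univ.image fun y : I => ((y : Y), c y) := by
    intro A hA
    obtain ⟨hinj, himg⟩ := h𝒜 A hA
    have hex : ∀ y : I, ∃ c, ((y : Y), c) ∈ A := by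
      rintro ⟨y, hy⟩
      rw [← himg] at hy
      obtain ⟨⟨y', c⟩, hc, rfl⟩ := Finset.mem_image.1 hy
      exact ⟨c, hc⟩
    choose c hc using hex
    refine Finset.mem_image.2 ⟨c, Finset.mem_univ _, ?_⟩
    ext ⟨y, z⟩
    simp only [Finset.mem_image, Finset.mem_univ, true_and, Prod.mk.injEq, Subtype.exists]
    constructor
    · rintro ⟨y', hy', rfl, rfl⟩
      exact hc ⟨y', hy'⟩
    · intro h
      have hy : y ∈ I := himg ▸ Finset.mem_image_of_mem Prod.fst h
      exact ⟨y, hy, rfl, congrArg Prod.snd (hinj (hc ⟨y, hy⟩) h rfl)⟩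
  calc 𝒜.card ≤ _ := Finset.card_le_card hsub
    _ ≤ (Finset.univ : Finset (I → C)).card := Finset.card_image_le
    _ = Fintype.card C ^ I.card := by simp

lemma card_le_sum_graphs {ι Y C : Type*} [Fintype ι] [Fintype Y] [DecidableEq Y] [DecidableEq C]
    [Fintype C] (A : ι → Finset (Y × C))
    (hinj : ∀ i, Set.InjOn Prod.fst (A i : Set (Y × C))) (b : Finset Y → ℕ)
    (hb : ∀ i, (Finset.univ.filter fun j => A j = A i).card ≤ b ((A i).image Prod.fst))
    (m : ℕ) (hm : ∀ i, (A i).card ≤ m) :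
    Fintype.card ι ≤ ∑ I ∈ Finset.univ.filter (fun I : Finset Y => I.card ≤ m),
      Fintype.card C ^ I.card * b I := by
  classical
  rw [← Finset.card_univ, Finset.card_eq_sum_card_image A]
  have hmaps : ∀ B ∈ Finset.univ.image A, B.image Prod.fst ∈
      Finset.univ.filter (fun I : Finset Y => I.card ≤ m) := by
    intro B hB
    obtain ⟨i, -, rfl⟩ := Finset.mem_image.1 hB
    exact Finset.mem_filter.2 ⟨Finset.mem_univ _, Finset.card_image_le.trans (hm i)⟩
  rw [← Finset.sum_fiberwise_of_maps_to hmaps]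
  refine Finset.sum_le_sum fun I _ => ?_
  calc _ ≤ ∑ B ∈ (Finset.univ.image A).filter (fun B => B.image Prod.fst = I), b I := by
        refine Finset.sum_le_sum fun B hB => ?_
        obtain ⟨hB, hI⟩ := Finset.mem_filter.1 hB
        obtain ⟨i, -, rfl⟩ := Finset.mem_image.1 hB
        exact hI ▸ hb i
    _ ≤ _ := by
        rw [Finset.sum_const, smul_eq_mul]
        refine Nat.mul_le_mul_right _ (card_graphs_le I _ fun B hB => ?_)
        obtain ⟨hB, hI⟩ := Finset.mem_filter.1 hB
        obtain ⟨i, -, rfl⟩ := Finset.mem_image.1 hB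
        exact ⟨hinj i, hI⟩

lemma sum_finset_subtype {X : Type*} [DecidableEq X] (Ps : Finset X) (m : ℕ) (f : Finset X → ℕ) :
    ∑ I ∈ Finset.univ.filter (fun I : Finset {p // p ∈ Ps} => I.card ≤ m),
      f (I.map (Function.Embedding.subtype _)) ≤
    ∑ I ∈ Ps.powerset.filter (fun I => I.card ≤ m), f I := by
  refine (Finset.sum_map _ (Finset.mapEmbedding
    (Function.Embedding.subtype (· ∈ Ps))).toEmbedding f).symm.le.trans ?_
  refine Finset.sum_le_sum_of_subset fun I hI => ?_
  obtain ⟨I', hI', rfl⟩ := Finset.mem_map.1 hI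
  have h := (Finset.mem_filter.1 hI').2
  simp only [RelEmbedding.coe_toEmbedding, Finset.mapEmbedding_apply, Finset.mem_filter,
    Finset.mem_powerset, Finset.card_map]
  refine ⟨fun x hx => ?_, h⟩
  obtain ⟨y, -, rfl⟩ := Finset.mem_map.1 hx
  exact y.2

end Counting

section Thickening

open Filter

/-- On a compact set, the points almost satisfying a system of polynomial conditions lie in any
neighbourhood of the points satisfying it. -/
lemma exists_thickening {k : ℕ} {B K W : Set (Fin k → ℝ)} (hB : IsCompact B) (hW : IsOpen W)
    (Q : MvPolynomial (Fin k) ℝ) (hQ : ∀ x, 0 ≤ eval x Q) (Ps : Finset (MvPolynomial (Fin k) ℝ))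
    {δ : ℝ} (hδ : 0 < δ)
    (hK : ∀ x ∈ B, eval x Q = 0 → (∀ P ∈ Ps, eval x P = 0 ∨ δ ≤ |eval x P|) → x ∈ K)
    (hKW : K ⊆ W) :
    ∃ η, 0 < η ∧ η < δ ∧ ∀ x ∈ B, eval x Q ≤ η →
      (∀ P ∈ Ps, |eval x P| ≤ η ∨ δ ≤ |eval x P|) → x ∈ W := by
  have hev : ∀ᶠ η : ℝ in nhds 0, ∀ x ∈ B \ W, ¬ (eval x Q ≤ η ∧
      ∀ P ∈ Ps, |eval x P| ≤ η ∨ δ ≤ |eval x P|) := by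
    refine (hB.diff hW).eventually_forall_of_forall_eventually fun x hx => ?_
    by_cases hQx : eval x Q = 0
    · have hP : ∃ P ∈ Ps, eval x P ≠ 0 ∧ |eval x P| < δ := by
        by_contra! hcon
        exact hx.2 (hKW (hK x hx.1 hQx fun P hP => or_iff_not_imp_left.2 (hcon P hP)))
      obtain ⟨P, hP, hP0, hPδ⟩ := hP
      have hc : Continuous fun z : ℝ × (Fin k → ℝ) => |eval z.2 P| :=
        ((continuous_eval' P).comp continuous_snd).abs
      filter_upwards [continuousAt_fst.eventually_lt hc.continuousAt (abs_pos.2 hP0),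
        hc.continuousAt.eventually_lt continuousAt_const hPδ] with z h1 h2 h3
      rcases h3.2 P hP with h | h <;> linarith
    · have hc : Continuous fun z : ℝ × (Fin k → ℝ) => eval z.2 Q :=
        (continuous_eval' Q).comp continuous_snd
      filter_upwards [continuousAt_fst.eventually_lt hc.continuousAt
        (lt_of_le_of_ne (hQ x) (Ne.symm hQx))] with z h1 h3
      linarith [h3.1]
  have hev' : ∀ᶠ η : ℝ in nhdsWithin 0 (Set.Ioi 0), 0 < η ∧ η < δ ∧ ∀ x ∈ B \ W,
      ¬ (eval x Q ≤ η ∧ ∀ P ∈ Ps, |eval x P| ≤ η ∨ δ ≤ |eval x P|) :=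
    Eventually.and self_mem_nhdsWithin
      (((gt_mem_nhds hδ).and hev).filter_mono nhdsWithin_le_nhds)
  obtain ⟨η, hη, hηδ, h⟩ := hev'.exists
  refine ⟨η, hη, hηδ, fun x hx hQx hPx => ?_⟩
  by_contra hxW
  exact h x ⟨hx, hxW⟩ ⟨hQx, hPx⟩

lemma sign_eq_of_isPreconnected {E : Type*} [TopologicalSpace E] {T : Set E}
    (hT : IsPreconnected T) {f : E → ℝ} (hf : Continuous f) {δ : ℝ} (hδ : 0 < δ)
    (hfT : ∀ x ∈ T, f x = 0 ∨ δ ≤ |f x|) {x y : E} (hx : x ∈ T) (hy : y ∈ T) :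
    SignType.sign (f x) = SignType.sign (f y) := by
  wlog hxy : f x ≤ f y generalizing x y
  · exact (this hy hx (le_of_not_ge hxy)).symm
  have hord := (hT.image f hf.continuousOn).ordConnected
  have hno : ∀ c : ℝ, c ≠ 0 → |c| < δ → f x ≤ c → c ≤ f y → False := by
    intro c hc0 hc h1 h2
    obtain ⟨z, hz, rfl⟩ := hord.out ⟨x, hx, rfl⟩ ⟨y, hy, rfl⟩ ⟨h1, h2⟩
    rcases hfT z hz with h | h
    · exact hc0 h
    · linarith
  rcases lt_trichotomy (f x) 0 with h | h | h
  · have h1 : f x ≤ -δ := by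
      rcases hfT x hx with h' | h'
      · exact absurd h' h.ne
      · rw [abs_of_neg h] at h'
        linarith
    have h2 : f y < 0 := by
      by_contra! hcon
      exact hno (-(δ / 2)) (by linarith) (by rw [abs_neg, abs_of_pos] <;> linarith)
        (by linarith) (by linarith)
    rw [sign_neg h, sign_neg h2]
  · have h2 : f y = 0 := by
      rcases hfT y hy with h' | h'
      · exact h'
      · rw [abs_of_nonneg (h ▸ hxy)] at h'
        exact (hno (δ / 2) (by linarith) (by rw [abs_of_pos] <;> linarith)
          (by linarith) (by linarith)).elim
    rw [h, h2]
  · rw [sign_pos h, sign_pos (h.trans_le hxy)]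

end Thickening

section Thresholds

/-- The thresholds used to relax a sign condition: the first two for positive and negative values,
the other two for zero values. -/
noncomputable def threshold (δ η : ℝ) : Fin 4 → ℝ := ![3 / 2 * δ, -(3 / 2 * δ), -(η / 2), η / 2]

/-- The direction of the inequality attached to a threshold. -/
def orientation : Fin 4 → ℝ := ![1, -1, 1, -1]

/-- The thresholds which are relevant for a value of given sign. -/
def Relevant (v : ℝ) (a : Fin 4) : Prop :=
  (0 < v ∧ a = 0) ∨ (v < 0 ∧ a = 1) ∨ (v = 0 ∧ (a = 2 ∨ a = 3))

variable {δ η κ v y : ℝ} {a b : Fin 4}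

lemma abs_orientation_le (a : Fin 4) : |orientation a| ≤ 1 := by
  fin_cases a <;> simp [orientation]

lemma Relevant.lt_sub_threshold (h : Relevant v a) (hη : 0 < η) (hηδ : η < δ)
    (hv : v ≠ 0 → 2 * δ < |v|) : η / 4 < orientation a * (v - threshold δ η a) := by
  rcases h with ⟨h, rfl⟩ | ⟨h, rfl⟩ | ⟨rfl, rfl | rfl⟩
  · have := hv h.ne'
    rw [abs_of_pos h] at this
    simp [orientation, threshold]
    linarith
  · have := hv h.ne
    rw [abs_of_neg h] at this
    simp [orientation, threshold]
    linarith
  · simp [orientation, threshold]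
    linarith
  · simp [orientation, threshold]
    linarith

lemma le_abs_of_relevant (hη : 0 < η) (hηδ : η < δ) (hκ : κ ≤ η / 4)
    (h : ∀ a, Relevant v a → -κ ≤ orientation a * (y - threshold δ η a)) :
    |y| ≤ η ∨ δ ≤ |y| := by
  rcases lt_trichotomy v 0 with hv | hv | hv
  · have := h 1 (Or.inr (Or.inl ⟨hv, rfl⟩))
    simp only [orientation, threshold, Matrix.cons_val] at this
    exact Or.inr (le_abs.2 (Or.inr (by linarith)))
  · have h2 := h 2 (Or.inr (Or.inr ⟨hv, Or.inl rfl⟩))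
    have h3 := h 3 (Or.inr (Or.inr ⟨hv, Or.inr rfl⟩))
    simp only [orientation, threshold, Matrix.cons_val] at h2 h3
    exact Or.inl (abs_le.2 ⟨by linarith, by linarith⟩)
  · have := h 0 (Or.inl ⟨hv, rfl⟩)
    simp only [orientation, threshold, Matrix.cons_val] at this
    exact Or.inr (le_abs.2 (Or.inl (by linarith)))

lemma Relevant.eq_of_abs_sub_le (ha : Relevant v a) (hb : Relevant v b) (hη : 0 < η)
    (hκ : κ ≤ η / 4) (hya : |y - threshold δ η a| ≤ κ) (hyb : |y - threshold δ η b| ≤ κ) :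
    a = b := by
  have h23 : |y - threshold δ η 2| ≤ κ → |y - threshold δ η 3| ≤ κ → False := by
    intro h2 h3
    simp only [threshold, Matrix.cons_val] at h2 h3
    linarith [(abs_le.1 h2).2, (abs_le.1 h3).1]
  rcases ha with ⟨ha, rfl⟩ | ⟨ha, rfl⟩ | ⟨rfl, rfl | rfl⟩ <;>
    rcases hb with ⟨hb, rfl⟩ | ⟨hb, rfl⟩ | ⟨hb, rfl | rfl⟩ <;>
    first | rfl | (exfalso; linarith) | exact (h23 hya hyb).elim | exact (h23 hyb hya).elim

end Thresholds

section Main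

open Filter

/-- A bound for the number of points of a real variety that are separated by the connected
components of the realizations of sign conditions. -/
theorem card_separated_le {k k' d₀ : ℕ} (hk' : k' ≤ k) (hd₀ : 1 ≤ d₀)
    (Qs Ps : Finset (MvPolynomial (Fin k) ℝ)) (hQdeg : ∀ q ∈ Qs, q.totalDegree ≤ d₀)
    {Z : Set (Fin k → ℝ)} (hZ : Z = {x | ∀ q ∈ Qs, eval x q = 0}) (hdim : dimH Z ≤ (k' : ℝ≥0∞))
    {n : ℕ} (p : Fin n → Fin k → ℝ) (hp : ∀ i, p i ∈ Z)
    (hsep : ∀ i j, i ≠ j → ∀ T ⊆ Z, IsPreconnected T →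
      (∀ P ∈ Ps, ∀ x ∈ T, ∀ y ∈ T, SignType.sign (eval x P) = SignType.sign (eval y P)) →
      p i ∈ T → p j ∉ T) :
    n ≤ ∑ I ∈ Ps.powerset.filter (fun I => I.card ≤ k'),
      4 ^ I.card * (k.choose (k - k' + I.card) * (2 * d₀) ^ (k - k') * (∏ P ∈ I, P.totalDegree) *
        (max (2 * d₀) (I.sup fun P => P.totalDegree)) ^ (k' - I.card)) := by
  classical
  rcases Nat.eq_zero_or_pos n with rfl | hn
  · exact Nat.zero_le _
  have : Nonempty (Fin n) := ⟨⟨0, hn⟩⟩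
  obtain ⟨Q, hQd, hQ0, hQZ⟩ : ∃ Q : MvPolynomial (Fin k) ℝ, Q.totalDegree ≤ 2 * d₀ ∧
      (∀ x, 0 ≤ eval x Q) ∧ ∀ x, eval x Q = 0 ↔ x ∈ Z := by
    have he : ∀ x : Fin k → ℝ, eval x (∑ q ∈ Qs, q ^ 2) = ∑ q ∈ Qs, eval x q ^ 2 := by simp
    refine ⟨∑ q ∈ Qs, q ^ 2, totalDegree_finsetSum_le fun q hq => ?_, fun x => ?_, fun x => ?_⟩
    · exact (totalDegree_pow q 2).trans (Nat.mul_le_mul_left 2 (hQdeg q hq))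
    · rw [he]
      positivity
    · rw [he, Finset.sum_eq_zero_iff_of_nonneg fun q _ => sq_nonneg _, hZ]
      simp
  have hpQ : ∀ i, eval (p i) Q = 0 := fun i => (hQZ _).2 (hp i)
  obtain ⟨M, hM⟩ : ∃ M, ∀ i, eval (p i) (sqNorm k) < M := by
    obtain ⟨M, hM⟩ := (Set.finite_range fun i => eval (p i) (sqNorm k)).bddAbove
    exact ⟨M + 1, fun i => lt_of_le_of_lt (hM ⟨i, rfl⟩) (lt_add_one M)⟩
  let B : Set (Fin k → ℝ) := {x | eval x (sqNorm k) ≤ M}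
  have hB : IsCompact B := by
    simp only [B, eval_sqNorm]
    exact isCompact_sum_sq_le M
  have hpB : ∀ i, p i ∈ B := fun i => (hM i).le
  obtain ⟨δ, hδ, hpδ⟩ : ∃ δ > 0, ∀ i, ∀ P ∈ Ps, eval (p i) P ≠ 0 → 2 * δ < |eval (p i) P| := by
    have hev : ∀ᶠ δ : ℝ in nhdsWithin 0 (Set.Ioi 0), 0 < δ ∧
        ∀ i, ∀ P ∈ Ps, eval (p i) P ≠ 0 → 2 * δ < |eval (p i) P| := by
      refine Eventually.and self_mem_nhdsWithin (Eventually.filter_mono nhdsWithin_le_nhds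
        (eventually_all.2 fun i => (Filter.eventually_all_finset Ps).2 fun P _ => ?_))
      by_cases h0 : eval (p i) P = 0
      · simp [h0]
      have hc : Continuous fun δ : ℝ => 2 * δ := by fun_prop
      filter_upwards [hc.continuousAt.eventually_lt continuousAt_const
        (by simpa using h0 : 2 * (0 : ℝ) < |eval (p i) P|)] with δ hδ _
      exact hδ
    obtain ⟨δ, h1, h2⟩ := hev.exists
    exact ⟨δ, h1, h2⟩
  let K : Set (Fin k → ℝ) := {x | x ∈ B ∧ eval x Q = 0 ∧ ∀ P ∈ Ps, eval x P = 0 ∨ δ ≤ |eval x P|}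
  have hK : IsCompact K := by
    refine hB.of_isClosed_subset ?_ fun x hx => hx.1
    refine hB.isClosed.inter (IsClosed.inter (isClosed_eq (continuous_eval' Q) continuous_const) ?_)
    have : {x : Fin k → ℝ | ∀ P ∈ Ps, eval x P = 0 ∨ δ ≤ |eval x P|} =
        ⋂ P ∈ Ps, {x | eval x P = 0} ∪ {x | δ ≤ |eval x P|} := by
      ext x
      simp
    change IsClosed {x : Fin k → ℝ | ∀ P ∈ Ps, eval x P = 0 ∨ δ ≤ |eval x P|}
    rw [this]
    exact isClosed_biInter fun P _ => (isClosed_eq (continuous_eval' P) continuous_const).union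
      (isClosed_le continuous_const (continuous_eval' P).abs)
  have hpK : ∀ i, p i ∈ K := fun i => ⟨hpB i, hpQ i, fun P hP => or_iff_not_imp_left.2 fun h0 => by
    linarith [hpδ i P hP h0]⟩
  obtain ⟨N, hN, hNd, hpN, hKN⟩ := exists_open_separation hK p hpK fun i j hij hmem =>
    hsep i j hij (connectedComponentIn K (p i))
      (fun x hx => (hQZ x).1 (connectedComponentIn_subset _ _ hx).2.1)
      isPreconnected_connectedComponentIn
      (fun P hP x hx y hy => sign_eq_of_isPreconnected isPreconnected_connectedComponentIn
        (continuous_eval' P) hδ (fun z hz => (connectedComponentIn_subset _ _ hz).2.2 P hP) hx hy)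
      (mem_connectedComponentIn (hpK i)) hmem
  obtain ⟨η, hη, hηδ, hηN⟩ := exists_thickening (K := K) hB (isOpen_iUnion hN) Q hQ0 Ps hδ
    (fun x hx hQx hPx => ⟨hx, hQx, hPx⟩) hKN
  let g : {P // P ∈ Ps} × Fin 4 → MvPolynomial (Fin k) ℝ := fun α => α.1.1
  let Rel : Fin n → Finset ({P // P ∈ Ps} × Fin 4) := fun i =>
    Finset.univ.filter fun α => Relevant (eval (p i) (g α)) α.2
  have hRel : ∀ i α, α ∈ Rel i ↔ Relevant (eval (p i) (g α)) α.2 := fun i α => by simp [Rel]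
  have hstrict : ∀ i, ∀ α ∈ Rel i,
      η / 4 < orientation α.2 * (eval (p i) (g α) - threshold δ η α.2) := fun i α hα =>
    ((hRel i α).1 hα).lt_sub_threshold hη hηδ (hpδ i α.1.1 α.1.2)
  have hU : ∀ i, {x | x ∈ N i ∧ eval x (sqNorm k) < M ∧ ∀ α ∈ Rel i,
      0 < orientation α.2 * (eval x (g α) - threshold δ η α.2)} ∈ nhds (p i) := by
    intro i
    refine Eventually.and ((hN i).mem_nhds (hpN i)) (Eventually.and ?_ ?_)
    · exact (continuous_eval' _).continuousAt.eventually_lt continuousAt_const (hM i)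
    · refine (Filter.eventually_all_finset _).2 fun α hα => ?_
      exact continuousAt_const.eventually_lt (continuous_const.mul
        ((continuous_eval' (g α)).sub continuous_const)).continuousAt
        ((by positivity : 0 < η / 4).trans (hstrict i α hα))
  have hr : k - k' + k' = k := Nat.sub_add_cancel hk'
  have hdimQ : dimH {x | eval x Q = 0} ≤ (k' : ℝ≥0∞) := by
    rwa [show {x | eval x Q = 0} = Z from Set.ext hQZ]
  obtain ⟨u, ε, θ, hε, hεη, hθ, β, q, hq⟩ := exists_fiber_points Q hQ0 hr hdimQ p hpQ _ hU hM hη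
  set Φ := Q + C ε * sqNorm k with hΦ
  have hΦe : ∀ x, eval x Φ = eval x Q + ε * eval x (sqNorm k) := fun x => by simp [hΦ]
  have hΦd : Φ.totalDegree ≤ 2 * d₀ := by
    refine (totalDegree_add _ _).trans (max_le hQd ((totalDegree_mul _ _).trans ?_))
    rw [totalDegree_C, zero_add]
    refine totalDegree_finsetSum_le fun i _ => (totalDegree_pow _ _).trans ?_
    rw [totalDegree_X]
    lia
  obtain ⟨κ, hκ0, hκη, hκθ⟩ : ∃ κ > 0, κ ≤ η / 4 ∧ θ + κ < ε * M :=
    ⟨min (η / 4) ((ε * M - θ) / 2), lt_min (by linarith) (by linarith), min_le_left _ _,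
      by linarith [min_le_right (η / 4) ((ε * M - θ) / 2)]⟩
  have hint : ∀ x, eval x (sqNorm k) < M → x ∈ interior B := fun x hx =>
    mem_interior.2 ⟨{x | eval x (sqNorm k) < M}, fun y (hy : eval y (sqNorm k) < M) =>
      (show eval y (sqNorm k) ≤ M from hy.le), isOpen_lt (continuous_eval' _) continuous_const, hx⟩
  have hcover : ∀ i, ∀ x ∈ B, eval x Φ ≤ θ + κ →
      (∀ α ∈ Rel i, -κ ≤ orientation α.2 * (eval x (g α) - threshold δ η α.2)) →
      x ∈ interior B ∧ x ∈ ⋃ j, N j := by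
    intro i x hx hxΦ hxα
    rw [hΦe] at hxΦ
    have h1 := hQ0 x
    have h2 := mul_nonneg hε.le (eval_sqNorm_nonneg x)
    refine ⟨hint x (lt_of_mul_lt_mul_left (by linarith) hε.le),
      hηN x hx (by linarith) fun P hP => ?_⟩
    exact le_abs_of_relevant (v := eval (p i) P) hη hηδ hκη fun a ha =>
      hxα (⟨P, hP⟩, a) ((hRel i _).2 ha)
  obtain ⟨A, hA, hcount⟩ := exists_active_sets Φ (fun l => dirDeriv (u l) Φ) g
    (fun α => threshold δ η α.2) (fun α => orientation α.2) Rel hB N hN hNd hκ0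
    (fun α => abs_orientation_le α.2) hcover q (fun i => (hq i).1.1)
    (fun i => hint _ (hq i).1.2.1) (fun i => (hq i).2.1) (fun i => (hq i).1.2.2) β
    (fun i => (hq i).2.2.1) (fun i => (hq i).2.2.2)
  have hinj : ∀ i, Set.InjOn Prod.fst (A i : Set ({P // P ∈ Ps} × Fin 4)) := by
    rintro i ⟨P, a⟩ ha ⟨P', b⟩ hb (rfl : P = P')
    obtain ⟨hsub, x, -, hx⟩ := hA i
    exact Prod.ext rfl (((hRel i _).1 (hsub ha)).eq_of_abs_sub_le ((hRel i _).1 (hsub hb)) hη hκη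
      (hx _ ha) (hx _ hb))
  have hdeg : ∀ i, ∀ α ∈ A i, 1 ≤ (g α).totalDegree := by
    intro i α hα
    obtain ⟨hsub, x, -, hx⟩ := hA i
    by_contra! h0
    have hconst := (totalDegree_eq_zero_iff_eq_C (p := g α)).1 (by lia)
    have h1 := hstrict i α (hsub hα)
    have h2 := hx α hα
    rw [hconst, eval_C] at h1 h2
    have h3 : |orientation α.2 * (coeff 0 (g α) - threshold δ η α.2)| ≤ κ := by
      rw [abs_mul]
      exact (mul_le_of_le_one_left (abs_nonneg _) (abs_orientation_le _)).trans h2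
    linarith [le_abs_self (orientation α.2 * (coeff 0 (g α) - threshold δ η α.2))]
  let b : Finset {P // P ∈ Ps} → ℕ := fun I =>
    (k.choose (k - k' + I.card) * (2 * d₀) ^ (k - k') * (∏ P ∈ I, P.1.totalDegree) *
        (max (2 * d₀) (I.sup fun P => P.1.totalDegree)) ^ (k' - I.card))
  have hcard : ∀ i, ((A i).image Prod.fst).card = (A i).card := fun i =>
    Finset.card_image_of_injOn (hinj i)
  have hbound : ∀ i, (Finset.univ.filter fun j => A j = A i).card ≤ b ((A i).image Prod.fst) := by
    intro i
    have h := hcount (A i) (fun α => (g α).totalDegree) (2 * d₀)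
      (max (2 * d₀) (((A i).image Prod.fst).sup fun P => P.1.totalDegree))
      (fun α hα => ⟨le_rfl, hdeg i α hα, ?_⟩) (fun l => ⟨?_, by lia, ?_⟩) ?_
    · refine h.trans (le_of_eq ?_)
      simp only [b, hcard]
      rw [Finset.prod_image (hinj i), show k - (k - k' + (A i).card) = k' - (A i).card by lia]
      ring
    · refine (Nat.sub_le _ _).trans (le_max_of_le_right ?_)
      exact Finset.le_sup (f := fun P : {P // P ∈ Ps} => P.1.totalDegree)
        (Finset.mem_image_of_mem Prod.fst hα)
    · exact (totalDegree_dirDeriv_le _ _).trans ((Nat.sub_le _ _).trans hΦd)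
    · exact (Nat.sub_le _ _).trans ((totalDegree_dirDeriv_le _ _).trans
        ((Nat.sub_le _ _).trans (hΦd.trans (le_max_left _ _))))
    · exact (Nat.sub_le _ _).trans (hΦd.trans (le_max_left _ _))
  have hAk : ∀ i, (A i).card ≤ k' := by
    intro i
    by_contra! hlt
    have h := hbound i
    simp only [b, hcard] at h
    rw [Nat.choose_eq_zero_of_lt (by lia), zero_mul, zero_mul, zero_mul, Nat.le_zero,
      Finset.card_eq_zero] at h
    exact Finset.notMem_empty i (h ▸ Finset.mem_filter.2 ⟨Finset.mem_univ i, rfl⟩)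
  have hfinal := card_le_sum_graphs A hinj b hbound k' hAk
  rw [Fintype.card_fin, Fintype.card_fin] at hfinal
  refine hfinal.trans (le_trans (le_of_eq ?_) (sum_finset_subtype Ps k' _))
  refine Finset.sum_congr rfl fun I _ => ?_
  simp only [b, Finset.card_map, Finset.prod_map, Finset.sup_map, Function.Embedding.subtype_apply,
    Function.comp_def]

end Main

/-- A preconnected subset of a set `S` meets a single connected component of `S`. -/
lemma connectedComponents_coe_eq_of_isPreconnected {X : Type*} [TopologicalSpace X] {S T : Set X}
    (hT : IsPreconnected T) (hTS : T ⊆ S) {x y : S} (hx : (x : X) ∈ T) (hy : (y : X) ∈ T) :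
    (x : ConnectedComponents S) = y := by
  have hpre : IsPreconnected (Subtype.val ⁻¹' T : Set S) := by
    rw [← Topology.IsInducing.subtypeVal.isPreconnected_image, Subtype.image_preimage_coe,
      Set.inter_eq_self_of_subset_right hTS]
    exact hT
  exact ConnectedComponents.coe_eq_coe'.2 (hpre.subset_connectedComponent hy hx)

/-- A type all of whose finite sets of elements have at most `N` elements is finite, with at most
`N` elements. -/
lemma finite_and_card_le_of_forall_finset {α : Type*} {N : ℕ}
    (h : ∀ T : Finset α, T.card ≤ N) : Finite α ∧ Nat.card α ≤ N := by
  have hfin : Finite α := by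
    by_contra hα
    rw [not_finite_iff_infinite] at hα
    obtain ⟨T, hT⟩ := Infinite.exists_subset_card_eq α (N + 1)
    have := h T
    lia
  refine ⟨hfin, ?_⟩
  have := Fintype.ofFinite α
  rw [Nat.card_eq_fintype_card]
  exact h Finset.univ

/-- The number of connected components of realizations of sign conditions is bounded by the number
of pairwise separated points of the variety. -/
lemma card_le_of_finset_components {k k' d₀ : ℕ} (hk' : k' ≤ k) (hd₀ : 1 ≤ d₀)
    (Qs Ps : Finset (MvPolynomial (Fin k) ℝ)) (hQdeg : ∀ q ∈ Qs, q.totalDegree ≤ d₀)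
    {Z : Set (Fin k → ℝ)} (hZ : Z = {x | ∀ q ∈ Qs, eval x q = 0}) (hdim : dimH Z ≤ (k' : ℝ≥0∞))
    (T : Finset (Σ σ : {p // p ∈ Ps} → SignType, ConnectedComponents
      ↥{x ∈ Z | ∀ p : {p // p ∈ Ps}, SignType.sign (eval x p.1) = σ p})) :
    T.card ≤ ∑ I ∈ Ps.powerset.filter (fun I => I.card ≤ k'),
      4 ^ I.card * (k.choose (k - k' + I.card) * (2 * d₀) ^ (k - k') *
        (∏ P ∈ I, P.totalDegree) *
        (max (2 * d₀) (I.sup fun P => P.totalDegree)) ^ (k' - I.card)) := by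
  have hrep : ∀ c : (Σ σ : {p // p ∈ Ps} → SignType, ConnectedComponents
      ↥{x ∈ Z | ∀ p : {p // p ∈ Ps}, SignType.sign (eval x p.1) = σ p}),
      ∃ x, ConnectedComponents.mk x = c.2 := fun c => ConnectedComponents.surjective_coe c.2
  choose x hx using hrep
  have hsame : ∀ c c', ∀ S ⊆ Z, IsPreconnected S →
      (∀ P ∈ Ps, ∀ y ∈ S, ∀ z ∈ S, SignType.sign (eval y P) = SignType.sign (eval z P)) →
      (x c : Fin k → ℝ) ∈ S → (x c' : Fin k → ℝ) ∈ S → c = c' := by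
    intro c c' S hSZ hS hsign hc hc'
    have hσ : c.1 = c'.1 := funext fun P => by
      rw [← (x c).2.2 P, ← (x c').2.2 P]
      exact hsign _ P.2 _ hc _ hc'
    have hxc := hx c
    have hxc' := hx c'
    generalize x c = y at *
    generalize x c' = z at *
    obtain ⟨σ, a⟩ := c
    obtain ⟨σ', a'⟩ := c'
    obtain rfl : σ = σ' := hσ
    refine congrArg (Sigma.mk σ) (hxc.symm.trans (Eq.trans ?_ hxc'))
    have hSσ : S ⊆ {x ∈ Z | ∀ p : {p // p ∈ Ps}, SignType.sign (eval x p.1) = σ p} :=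
      fun w hw => ⟨hSZ hw, fun P => (hsign _ P.2 _ hw _ hc).trans (y.2.2 P)⟩
    exact connectedComponents_coe_eq_of_isPreconnected hS hSσ hc hc'
  refine card_separated_le hk' hd₀ Qs Ps hQdeg hZ hdim (fun i => (x (T.equivFin.symm i)).1)
    (fun i => (x _).2.1) fun i j hij S hSZ hS hsign hi hj => hij ?_
  exact T.equivFin.symm.injective (Subtype.ext (hsame _ _ S hSZ hS hsign hi hj))

end SignCondition

/-- bound on the total number of connected components of all
realizations of sign conditions of a family `Ps` on a real variety `Z` of
Hausdorff dimension at most `k'`, with refined dependence on the degrees. -/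
theorem stmt0 (k k' d₀ : ℕ) (hk : 1 ≤ k) (hk' : k' ≤ k) (hd₀ : 1 ≤ d₀)
    (Qs Ps : Finset (MvPolynomial (Fin k) ℝ))
    (hQdeg : ∀ q ∈ Qs, q.totalDegree ≤ d₀)
    (Z : Set (Fin k → ℝ))
    (hZ : Z = {x | ∀ q ∈ Qs, MvPolynomial.eval x q = 0})
    (hdim : dimH Z ≤ (k' : ℝ≥0∞)) :
    (∀ σ : {p // p ∈ Ps} → SignType,
      Finite (ConnectedComponents
        ↥{x ∈ Z | ∀ p : {p // p ∈ Ps}, SignType.sign (MvPolynomial.eval x p.1) = σ p})) ∧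
    (∑ σ : {p // p ∈ Ps} → SignType,
      Nat.card (ConnectedComponents
        ↥{x ∈ Z | ∀ p : {p // p ∈ Ps}, SignType.sign (MvPolynomial.eval x p.1) = σ p}))
      ≤ ∑ I ∈ Ps.powerset.filter (fun I => I.card ≤ k'),
          4 ^ I.card *
            (Nat.choose (k + 1) (k - k' + I.card + 1) * (2 * d₀) ^ (k - k') *
                (∏ p ∈ I, p.totalDegree) *
                (max (2 * d₀) (I.sup fun p => p.totalDegree)) ^ (k' - I.card)
              + 2 * (k - I.card + 1)) := by
  obtain ⟨hfin, hcard⟩ := SignCondition.finite_and_card_le_of_forall_finset fun T =>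
    SignCondition.card_le_of_finset_components hk' hd₀ Qs Ps hQdeg hZ hdim T
  have hfib : ∀ σ : {p // p ∈ Ps} → SignType, Finite (ConnectedComponents
        ↥{x ∈ Z | ∀ p : {p // p ∈ Ps}, SignType.sign (MvPolynomial.eval x p.1) = σ p}) :=
    fun σ => by
      refine @Finite.of_injective _ _ hfin (fun c => ⟨σ, c⟩) fun a b hab => ?_
      simpa using hab
  refine ⟨hfib, ?_⟩
  rw [← Nat.card_sigma]
  refine hcard.trans (Finset.sum_le_sum fun I _ => Nat.mul_le_mul_left _ ?_)
  refine le_add_right ?_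
  gcongr
  exact (Nat.choose_succ_succ k (k - k' + I.card)).symm ▸ Nat.le_add_right _ _
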